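/- For z ∈ ℝ^N and u : ℝ^N → ℝ set S_j(z,u) = sup_{B(z,2^{−j})} |u| and 𝕄(z,u) = {j ∈ ℕ : 4·S_{j+1}(z,u) ≥ S_j(z,u)}. There exists a constant C₀ depending only on N such that if u ∈ P₁(z,M) then S_j(z,u) ≤ C₀·M·2^{−2j} for all j ∈ 𝕄(z,u). -/

import Mathlib

open MeasureTheory Metric Set Filter
open scoped RealInnerProductSpace

noncomputable section

/-- The Laplacian of `φ` at `x`, as the sum of the pure second derivatives. -/
def lap (N : ℕ) (φ : EuclideanSpace ℝ (Fin N) → ℝ) (x : EuclideanSpace ℝ (Fin N)) : ℝ :=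
  ∑ i : Fin N,
    fderiv ℝ (fun y => fderiv ℝ φ y (EuclideanSpace.single i 1)) x (EuclideanSpace.single i 1)

/-- Membership in the class `P_r(z, M)`. -/
def MemP (N : ℕ) (r : ℝ) (z : EuclideanSpace ℝ (Fin N)) (M : ℝ)
    (Ω : Set (EuclideanSpace ℝ (Fin N))) (u : EuclideanSpace ℝ (Fin N) → ℝ) : Prop :=
  IsOpen Ω ∧ ContDiff ℝ 1 u ∧
    (∀ φ : EuclideanSpace ℝ (Fin N) → ℝ, ContDiff ℝ (⊤ : ℕ∞) φ → tsupport φ ⊆ ball z r →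
      ∫ x, u x * lap N φ x = ∫ x in Ω, φ x) ∧
    (∀ x ∈ ball z r \ Ω, u x = 0 ∧ gradient u x = 0) ∧
    (∀ x ∈ ball z r, |u x| ≤ M) ∧
    z ∈ frontier Ω

/-- Membership in the class `P_∞(0, M)` of global solutions with quadratic growth. -/
def MemPinf (N : ℕ) (M : ℝ) (Ω : Set (EuclideanSpace ℝ (Fin N)))
    (u : EuclideanSpace ℝ (Fin N) → ℝ) : Prop :=
  IsOpen Ω ∧ ContDiff ℝ 1 u ∧
    (∀ φ : EuclideanSpace ℝ (Fin N) → ℝ, ContDiff ℝ (⊤ : ℕ∞) φ → HasCompactSupport φ →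
      ∫ x, u x * lap N φ x = ∫ x in Ω, φ x) ∧
    (∀ x ∈ Ωᶜ, u x = 0 ∧ gradient u x = 0) ∧
    (0 : EuclideanSpace ℝ (Fin N)) ∈ frontier Ω ∧
    (∀ x, |u x| ≤ M * (‖x‖ ^ 2 + 1))

/-- The minimum diameter of a set: the smallest width of a slab containing it. -/
def MD (N : ℕ) (D : Set (EuclideanSpace ℝ (Fin N))) : ℝ :=
  ⨅ e : {e : EuclideanSpace ℝ (Fin N) // ‖e‖ = 1},
    ((⨆ x : D, ⟪(x : EuclideanSpace ℝ (Fin N)), (e : EuclideanSpace ℝ (Fin N))⟫) -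
      ⨅ x : D, ⟪(x : EuclideanSpace ℝ (Fin N)), (e : EuclideanSpace ℝ (Fin N))⟫)

/-- The density function `δ_r(u)`. -/
def deltaFn (N : ℕ) (u : EuclideanSpace ℝ (Fin N) → ℝ) (r : ℝ) : ℝ :=
  MD N ({x | u x = 0 ∧ gradient u x = 0} ∩ ball 0 r) / r

/-- Half-space solutions `x ↦ (max(⟪x,e⟫,0))²/2`. -/
def IsHalfSpaceSol (N : ℕ) (u : EuclideanSpace ℝ (Fin N) → ℝ) : Prop :=
  ∃ e : EuclideanSpace ℝ (Fin N), ‖e‖ = 1 ∧ ∀ x, u x = (max ⟪x, e⟫ 0) ^ 2 / 2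

/-- `∂Ω ∩ B` is the graph of a `C¹` function. -/
def IsC1Graph (N : ℕ) (Ω B : Set (EuclideanSpace ℝ (Fin N))) : Prop :=
  ∃ (e : EuclideanSpace ℝ (Fin N)) (f : EuclideanSpace ℝ (Fin N) → ℝ),
    ‖e‖ = 1 ∧ ContDiff ℝ 1 f ∧
    Ω ∩ B = {x ∈ B | f (x - ⟪x, e⟫ • e) < ⟪x, e⟫} ∧
    frontier Ω ∩ B = {x ∈ B | ⟪x, e⟫ = f (x - ⟪x, e⟫ • e)}

/-- `∂Ω ∩ B` is the graph of a real-analytic function. -/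
def IsAnalyticGraph (N : ℕ) (Ω B : Set (EuclideanSpace ℝ (Fin N))) : Prop :=
  ∃ (e : EuclideanSpace ℝ (Fin N)) (f : EuclideanSpace ℝ (Fin N) → ℝ),
    ‖e‖ = 1 ∧ (∀ x, AnalyticAt ℝ f x) ∧
    Ω ∩ B = {x ∈ B | f (x - ⟪x, e⟫ • e) < ⟪x, e⟫} ∧
    frontier Ω ∩ B = {x ∈ B | ⟪x, e⟫ = f (x - ⟪x, e⟫ • e)}

/-- The Alt–Caffarelli–Friedman functional `φ(r, v)` centered at the origin. -/
def acf (N : ℕ) (v : EuclideanSpace ℝ (Fin N) → ℝ) (r : ℝ) : ℝ :=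
  r ^ (-4 : ℤ) *
    (∫ x in ball (0 : EuclideanSpace ℝ (Fin N)) r,
      ‖gradient (fun y => max (v y) 0) x‖ ^ 2 * ‖x‖ ^ ((2 : ℤ) - (N : ℤ))) *
    ∫ x in ball (0 : EuclideanSpace ℝ (Fin N)) r,
      ‖gradient (fun y => max (-v y) 0) x‖ ^ 2 * ‖x‖ ^ ((2 : ℤ) - (N : ℤ))

/-- `S_j(z, u) = sup_{B(z, 2^{-j})} |u|`. -/
def Sj (N : ℕ) (z : EuclideanSpace ℝ (Fin N)) (u : EuclideanSpace ℝ (Fin N) → ℝ) (j : ℕ) : ℝ :=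
  sSup ((fun x => |u x|) '' ball z ((2 : ℝ) ^ (-(j : ℤ))))

section

open scoped Topology ContDiff

local notation "𝔼" N => EuclideanSpace ℝ (Fin N)

variable {N : ℕ}

section

/-! ### Directional derivatives and test functions -/

/-- The directional derivative of `φ` along `v`. -/
def dd (v : 𝔼 N) (φ : (𝔼 N) → ℝ) : (𝔼 N) → ℝ := fun x => fderiv ℝ φ x v

/-- Smooth functions supported in the closed ball of radius `R`. -/
def IsTest (R : ℝ) (φ : (𝔼 N) → ℝ) : Prop :=
  ContDiff ℝ ∞ φ ∧ tsupport φ ⊆ closedBall 0 R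

lemma lap_eq_sum (φ : (𝔼 N) → ℝ) (x : 𝔼 N) :
    lap N φ x = ∑ i : Fin N, dd (EuclideanSpace.single i 1) (dd (EuclideanSpace.single i 1) φ) x :=
  rfl

lemma ContDiff.dir {φ : (𝔼 N) → ℝ} (h : ContDiff ℝ ∞ φ) (v : 𝔼 N) : ContDiff ℝ ∞ (dd v φ) :=
  (h.fderiv_right (m := ∞) (by simp)).clm_apply contDiff_const

lemma ContDiff.laplace {φ : (𝔼 N) → ℝ} (h : ContDiff ℝ ∞ φ) : ContDiff ℝ ∞ (lap N φ) := by
  have : lap N φ = fun x => ∑ i : Fin N,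
      dd (EuclideanSpace.single i 1) (dd (EuclideanSpace.single i 1) φ) x := rfl
  rw [this]
  exact ContDiff.sum fun i _ => (h.dir _).dir _

lemma dd_add {φ ψ : (𝔼 N) → ℝ} (hφ : ContDiff ℝ ∞ φ) (hψ : ContDiff ℝ ∞ ψ) (v : 𝔼 N) :
    dd v (fun x => φ x + ψ x) = fun x => dd v φ x + dd v ψ x := by
  ext x
  simp only [dd]
  rw [fderiv_fun_add (hφ.differentiable (by simp) x) (hψ.differentiable (by simp) x)]
  rfl

lemma dd_sub {φ ψ : (𝔼 N) → ℝ} (hφ : ContDiff ℝ ∞ φ) (hψ : ContDiff ℝ ∞ ψ) (v : 𝔼 N) :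
    dd v (fun x => φ x - ψ x) = fun x => dd v φ x - dd v ψ x := by
  ext x
  simp only [dd]
  rw [fderiv_fun_sub (hφ.differentiable (by simp) x) (hψ.differentiable (by simp) x)]
  rfl

lemma dd_const_mul {φ : (𝔼 N) → ℝ} (hφ : ContDiff ℝ ∞ φ) (c : ℝ) (v : 𝔼 N) :
    dd v (fun x => c * φ x) = fun x => c * dd v φ x := by
  ext x
  simp only [dd]
  rw [fderiv_const_mul (hφ.differentiable (by simp) x)]
  rfl

lemma dd_sum {ι : Type*} (s : Finset ι) {φ : ι → (𝔼 N) → ℝ} (hφ : ∀ i ∈ s, ContDiff ℝ ∞ (φ i))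
    (v : 𝔼 N) : dd v (fun x => ∑ i ∈ s, φ i x) = fun x => ∑ i ∈ s, dd v (φ i) x := by
  ext x
  simp only [dd]
  rw [fderiv_fun_sum fun i hi => (hφ i hi).differentiable (by simp) x]
  simp

lemma dd_comp_affine {φ : (𝔼 N) → ℝ} (hφ : ContDiff ℝ ∞ φ) (a : 𝔼 N) (c : ℝ) (v : 𝔼 N) :
    dd v (fun y => φ (a + c • y)) = fun x => c * dd v φ (a + c • x) := by
  ext x
  have h1 : HasFDerivAt (fun y : 𝔼 N => a + c • y) (c • ContinuousLinearMap.id ℝ (𝔼 N)) x :=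
    ((hasFDerivAt_id x).const_smul c).const_add a
  have h2 := ((hφ.differentiable (by simp)) (a + c • x)).hasFDerivAt.comp x h1
  have h3 : fderiv ℝ (fun y => φ (a + c • y)) x = _ := h2.fderiv
  simp [dd, h3]

lemma dd_comm {φ : (𝔼 N) → ℝ} (hφ : ContDiff ℝ ∞ φ) (v w : 𝔼 N) :
    dd v (dd w φ) = dd w (dd v φ) := by
  ext x
  have hd : DifferentiableAt ℝ (fderiv ℝ φ) x :=
    (hφ.fderiv_right (m := 1) (by norm_cast)).differentiable (by simp) x
  have key : ∀ a b : 𝔼 N, dd a (dd b φ) x = fderiv ℝ (fderiv ℝ φ) x a b := by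
    intro a b
    have : fderiv ℝ (dd b φ) x = _ :=
      (hd.hasFDerivAt.clm_apply (hasFDerivAt_const b x)).fderiv
    rw [dd, this]
    simp
  rw [key, key]
  exact second_derivative_symmetric (f := φ) (f' := fderiv ℝ φ)
    (fun y => (hφ.differentiable (by simp) y).hasFDerivAt) hd.hasFDerivAt v w

lemma lap_dd {φ : (𝔼 N) → ℝ} (hφ : ContDiff ℝ ∞ φ) (v : 𝔼 N) :
    lap N (dd v φ) = dd v (lap N φ) := by
  have : lap N φ = fun x => ∑ i : Fin N,
      dd (EuclideanSpace.single i 1) (dd (EuclideanSpace.single i 1) φ) x := rfl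
  rw [this, dd_sum _ fun i _ => (hφ.dir _).dir _]
  ext x
  rw [lap_eq_sum]
  refine Finset.sum_congr rfl fun i _ => ?_
  rw [dd_comm hφ, dd_comm (hφ.dir _)]

lemma lap_comp_affine {φ : (𝔼 N) → ℝ} (hφ : ContDiff ℝ ∞ φ) (a : 𝔼 N) (c : ℝ) (x : 𝔼 N) :
    lap N (fun y => φ (a + c • y)) x = c ^ 2 * lap N φ (a + c • x) := by
  rw [lap_eq_sum, lap_eq_sum, Finset.mul_sum]
  refine Finset.sum_congr rfl fun i _ => ?_
  rw [dd_comp_affine hφ, dd_const_mul, dd_comp_affine (hφ.dir _)]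
  · ring
  · exact (hφ.dir _).comp (by fun_prop)

lemma lap_const_mul {φ : (𝔼 N) → ℝ} (hφ : ContDiff ℝ ∞ φ) (c : ℝ) (x : 𝔼 N) :
    lap N (fun y => c * φ y) x = c * lap N φ x := by
  rw [lap_eq_sum, lap_eq_sum, Finset.mul_sum]
  refine Finset.sum_congr rfl fun i _ => ?_
  rw [dd_const_mul hφ, dd_const_mul (hφ.dir _)]

lemma lap_sum {ι : Type*} (s : Finset ι) {φ : ι → (𝔼 N) → ℝ} (hφ : ∀ i ∈ s, ContDiff ℝ ∞ (φ i))
    (x : 𝔼 N) : lap N (fun y => ∑ i ∈ s, φ i y) x = ∑ i ∈ s, lap N (φ i) x := by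
  simp only [lap_eq_sum]
  rw [Finset.sum_comm]
  refine Finset.sum_congr rfl fun i _ => ?_
  rw [dd_sum s hφ, dd_sum s fun j hj => (hφ j hj).dir _]

namespace IsTest

variable {R : ℝ} {φ ψ : (𝔼 N) → ℝ}

lemma continuous (h : IsTest R φ) : Continuous φ := h.1.continuous

lemma hasCompactSupport (h : IsTest R φ) : HasCompactSupport φ :=
  (isCompact_closedBall _ _).of_isClosed_subset (isClosed_tsupport φ) h.2

lemma integrable (h : IsTest R φ) : Integrable φ :=
  h.continuous.integrable_of_hasCompactSupport h.hasCompactSupport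

lemma dir (h : IsTest R φ) (v : 𝔼 N) : IsTest R (dd v φ) :=
  ⟨h.1.dir v, (tsupport_fderiv_apply_subset ℝ v).trans h.2⟩

lemma eq_zero (h : IsTest R φ) {x : 𝔼 N} (hx : R < ‖x‖) : φ x = 0 := by
  by_contra hne
  have := h.2 (subset_tsupport φ hne)
  simp at this
  linarith

lemma of_eq_zero (h : ContDiff ℝ ∞ φ) (h0 : ∀ x, R < ‖x‖ → φ x = 0) : IsTest R φ := by
  refine ⟨h, closure_minimal ?_ isClosed_closedBall⟩
  intro x hx
  by_contra hne
  simp only [mem_closedBall, dist_zero_right, not_le] at hne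
  exact hx (h0 x hne)

lemma laplace (h : IsTest R φ) : IsTest R (lap N φ) := by
  refine of_eq_zero h.1.laplace fun x hx => ?_
  rw [lap_eq_sum]
  exact Finset.sum_eq_zero fun i _ => ((h.dir _).dir _).eq_zero hx

lemma exists_bound (h : IsTest R φ) : ∃ C, 0 ≤ C ∧ ∀ x, |φ x| ≤ C := by
  obtain ⟨C, hC⟩ := h.hasCompactSupport.exists_bound_of_continuous h.continuous
  exact ⟨C, (norm_nonneg _).trans (hC 0), hC⟩

end IsTest

/-! ### Integration by parts and the `L²` Hessian estimate -/

lemma integral_mul_dd {f g : (𝔼 N) → ℝ} (hf : ContDiff ℝ ∞ f) (hg : ContDiff ℝ ∞ g)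
    (hc : HasCompactSupport g) (v : 𝔼 N) :
    ∫ x, f x * dd v g x = - ∫ x, dd v f x * g x := by
  have hc' : HasCompactSupport (dd v g) :=
    hc.mono' (subset_closure.trans (tsupport_fderiv_apply_subset ℝ v))
  refine integral_mul_fderiv_eq_neg_fderiv_mul_of_integrable ?_ ?_ ?_
    (fun x _ => hf.differentiable (by simp) x) (fun x _ => hg.differentiable (by simp) x)
  · exact ((hf.dir v).continuous.mul hg.continuous).integrable_of_hasCompactSupport hc.mul_left
  · exact (hf.continuous.mul (hg.dir v).continuous).integrable_of_hasCompactSupport hc'.mul_left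
  · exact (hf.continuous.mul hg.continuous).integrable_of_hasCompactSupport hc.mul_left

lemma IsTest.integral_dd {R : ℝ} {φ : (𝔼 N) → ℝ} (h : IsTest R φ) (v : 𝔼 N) :
    ∫ x, dd v φ x = 0 := by
  have h1 := integral_mul_dd (f := fun _ => (1 : ℝ)) contDiff_const h.1 h.hasCompactSupport v
  have : dd v (fun _ : 𝔼 N => (1 : ℝ)) = fun _ => 0 := by ext; simp [dd]
  simpa [this] using h1

lemma IsTest.integral_mixed_sq {R : ℝ} {φ : (𝔼 N) → ℝ} (h : IsTest R φ) (v w : 𝔼 N) :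
    ∫ x, dd v (dd w φ) x ^ 2 = ∫ x, dd v (dd v φ) x * dd w (dd w φ) x := by
  calc ∫ x, dd v (dd w φ) x ^ 2 = ∫ x, dd v (dd w φ) x * dd v (dd w φ) x := by simp only [sq]
    _ = - ∫ x, dd v (dd v (dd w φ)) x * dd w φ x :=
        integral_mul_dd ((h.1.dir w).dir v) (h.1.dir w) (h.dir w).hasCompactSupport v
    _ = - ∫ x, dd w (dd v (dd v φ)) x * dd w φ x := by
        rw [dd_comm h.1 v w, dd_comm (h.1.dir v) v w]
    _ = _ := (integral_mul_dd ((h.1.dir v).dir v) (h.1.dir w) (h.dir w).hasCompactSupport w).symm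

lemma dd_eq_sum (φ : (𝔼 N) → ℝ) (v x : 𝔼 N) :
    dd v φ x = ∑ i : Fin N, v i * dd (EuclideanSpace.single i 1) φ x := by
  have hv : v = ∑ i : Fin N, v i • EuclideanSpace.single i (1 : ℝ) := by
    ext j
    simp [Pi.single_apply]
  simp only [dd]
  conv_lhs => rw [hv, map_sum]
  simp

lemma sq_dd_dd_le {φ : (𝔼 N) → ℝ} (h : ContDiff ℝ ∞ φ) (v x : 𝔼 N) (hv : ‖v‖ ≤ 1) :
    dd v (dd v φ) x ^ 2 ≤ ∑ i : Fin N, ∑ j : Fin N,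
      dd (EuclideanSpace.single i 1) (dd (EuclideanSpace.single j 1) φ) x ^ 2 := by
  have hs : ∑ i : Fin N, v i ^ 2 ≤ 1 := by
    have := EuclideanSpace.norm_sq_eq v
    simp only [Real.norm_eq_abs, sq_abs] at this
    rw [← this]
    nlinarith [norm_nonneg v]
  have e : dd v (dd v φ) x = ∑ i : Fin N, v i *
      dd v (dd (EuclideanSpace.single i 1) φ) x := by
    rw [dd_eq_sum]
    exact Finset.sum_congr rfl fun i _ => by rw [dd_comm h]
  have cs : ∀ a : Fin N → ℝ, (∑ i, v i * a i) ^ 2 ≤ ∑ i, a i ^ 2 := by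
    intro a
    refine (Finset.sum_mul_sq_le_sq_mul_sq _ _ _).trans ?_
    exact mul_le_of_le_one_left (Finset.sum_nonneg fun i _ => sq_nonneg _) hs
  rw [e]
  refine (cs _).trans ?_
  rw [Finset.sum_comm]
  refine Finset.sum_le_sum fun i _ => ?_
  rw [dd_eq_sum]
  exact cs _

lemma IsTest.integral_sq_dd_dd_le {R : ℝ} {φ : (𝔼 N) → ℝ} (h : IsTest R φ) {v : 𝔼 N}
    (hv : ‖v‖ ≤ 1) : ∫ x, dd v (dd v φ) x ^ 2 ≤ ∫ x, lap N φ x ^ 2 := by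
  have hint : ∀ a b c d : 𝔼 N, Integrable fun x => dd a (dd b φ) x * dd c (dd d φ) x :=
    fun a b c d => (((h.dir b).dir a).continuous.mul ((h.dir d).dir c).continuous
      ).integrable_of_hasCompactSupport ((h.dir d).dir c).hasCompactSupport.mul_left
  calc ∫ x, dd v (dd v φ) x ^ 2
      ≤ ∫ x, ∑ i : Fin N, ∑ j : Fin N,
        dd (EuclideanSpace.single i 1) (dd (EuclideanSpace.single j 1) φ) x ^ 2 := by
        refine integral_mono ?_ ?_ fun x => sq_dd_dd_le h.1 v x hv
        · simpa only [sq] using hint v v v v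
        · refine integrable_finsetSum _ fun i _ => integrable_finsetSum _ fun j _ => ?_
          simpa only [sq] using hint _ _ _ _
    _ = ∑ i : Fin N, ∑ j : Fin N, ∫ x,
        dd (EuclideanSpace.single i 1) (dd (EuclideanSpace.single i 1) φ) x *
        dd (EuclideanSpace.single j 1) (dd (EuclideanSpace.single j 1) φ) x := by
        rw [integral_finsetSum]
        · refine Finset.sum_congr rfl fun i _ => ?_
          rw [integral_finsetSum]
          · exact Finset.sum_congr rfl fun j _ => h.integral_mixed_sq _ _
          · intro j _
            simpa only [sq] using hint _ _ _ _
        · refine fun i _ => integrable_finsetSum _ fun j _ => ?_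
          simpa only [sq] using hint _ _ _ _
    _ = ∫ x, lap N φ x ^ 2 := by
        have : ∀ x, lap N φ x ^ 2 = ∑ i : Fin N, ∑ j : Fin N,
            dd (EuclideanSpace.single i 1) (dd (EuclideanSpace.single i 1) φ) x *
            dd (EuclideanSpace.single j 1) (dd (EuclideanSpace.single j 1) φ) x := by
          intro x
          rw [sq, lap_eq_sum, Finset.sum_mul_sum]
        simp only [this]
        rw [integral_finsetSum _ fun i _ => integrable_finsetSum _ fun j _ => hint _ _ _ _]
        refine Finset.sum_congr rfl fun i _ => ?_
        rw [integral_finsetSum _ fun j _ => hint _ _ _ _]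

end

section

/-! ### Radial kernels -/

lemma dd_radial {g g' : ℝ → ℝ} (hg : ∀ s, HasDerivAt g (g' s) s) (v : 𝔼 N) :
    dd v (fun x => g (‖x‖ ^ 2)) = fun x => g' (‖x‖ ^ 2) * (2 * ⟪x, v⟫) := by
  ext x
  have h1 := (hasStrictFDerivAt_norm_sq x).hasFDerivAt
  have h2 : fderiv ℝ (fun x : 𝔼 N => g (‖x‖ ^ 2)) x = _ :=
    ((hg (‖x‖ ^ 2)).comp_hasFDerivAt x h1).fderiv
  simp [dd, h2]

lemma lap_radial {g g' g'' : ℝ → ℝ} (hg : ∀ s, HasDerivAt g (g' s) s)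
    (hg' : ∀ s, HasDerivAt g' (g'' s) s) (x : 𝔼 N) :
    lap N (fun x => g (‖x‖ ^ 2)) x = 4 * ‖x‖ ^ 2 * g'' (‖x‖ ^ 2) + 2 * N * g' (‖x‖ ^ 2) := by
  have key : ∀ v : 𝔼 N, dd v (dd v (fun x => g (‖x‖ ^ 2))) x =
      g'' (‖x‖ ^ 2) * (2 * ⟪x, v⟫) ^ 2 + g' (‖x‖ ^ 2) * (2 * ⟪v, v⟫) := by
    intro v
    rw [dd_radial hg]
    have h1 := (hg' (‖x‖ ^ 2)).comp_hasFDerivAt x (hasStrictFDerivAt_norm_sq x).hasFDerivAt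
    have h2 : HasFDerivAt (fun y : 𝔼 N => 2 * ⟪y, v⟫) ((2 : ℝ) • (innerSL ℝ v)) x := by
      have : (fun y : 𝔼 N => 2 * ⟪y, v⟫) = fun y => ((2 : ℝ) • (innerSL ℝ v)) y := by
        ext y
        simp [real_inner_comm]
      rw [this]
      exact ContinuousLinearMap.hasFDerivAt _
    have h3 : fderiv ℝ (fun x : 𝔼 N => g' (‖x‖ ^ 2) * (2 * ⟪x, v⟫)) x = _ := (h1.mul h2).fderiv
    simp [dd, h3]
    ring
  rw [lap_eq_sum]
  simp only [key]
  rw [Finset.sum_add_distrib, ← Finset.mul_sum, ← Finset.mul_sum]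
  have e1 : ∑ i : Fin N, (2 * ⟪x, EuclideanSpace.single i (1 : ℝ)⟫) ^ 2 = 4 * ‖x‖ ^ 2 := by
    rw [EuclideanSpace.norm_sq_eq, Finset.mul_sum]
    refine Finset.sum_congr rfl fun i _ => ?_
    rw [EuclideanSpace.inner_single_right]
    simp
    ring
  have e2 : ∑ i : Fin N, 2 * ⟪EuclideanSpace.single i (1 : ℝ), EuclideanSpace.single i (1 : ℝ)⟫ =
      2 * N := by
    simp
    ring
  rw [e1, e2]
  ring

/-- A smooth monotone step, equal to `0` for `s ≤ 1/4` and to `1` for `s ≥ 1`. -/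
def step (s : ℝ) : ℝ := Real.smoothTransition ((4 * s - 1) / 3)

lemma contDiff_step : ContDiff ℝ ∞ step := by
  unfold step
  exact Real.smoothTransition.contDiff.comp (by fun_prop)

lemma step_eq_zero {s : ℝ} (h : s ≤ 1 / 4) : step s = 0 :=
  Real.smoothTransition.zero_of_nonpos (by linarith)

lemma step_eq_one {s : ℝ} (h : 1 ≤ s) : step s = 1 :=
  Real.smoothTransition.one_of_one_le (by linarith)

lemma step_mono : Monotone step := fun a b h =>
  Real.smoothTransition.monotone (by linarith)

/-- The smooth profile which agrees with `s ^ (-N/2)` for `s ≥ 1`. -/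
def profile (N : ℕ) (s : ℝ) : ℝ := step s * (√s)⁻¹ ^ N

lemma contDiff_profile (N : ℕ) : ContDiff ℝ ∞ (profile N) := by
  rw [contDiff_iff_contDiffAt]
  intro s
  rcases lt_or_ge s (1 / 4) with h | h
  · have : profile N =ᶠ[𝓝 s] fun _ => 0 := by
      filter_upwards [Iio_mem_nhds h] with a ha
      rw [profile, step_eq_zero (le_of_lt ha), zero_mul]
    exact contDiffAt_const.congr_of_eventuallyEq this
  · have hs : s ≠ 0 := by linarith
    exact contDiff_step.contDiffAt.mul
      (((Real.contDiffAt_sqrt hs).inv (by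
        rw [Real.sqrt_ne_zero']; linarith)).pow N)

lemma deriv_profile (N : ℕ) {s : ℝ} (hs : 0 < s) :
    4 * s * deriv (profile N) s + 2 * N * profile N s =
      4 * s * deriv step s * (√s)⁻¹ ^ N := by
  have h1 : HasDerivAt step (deriv step s) s :=
    (contDiff_step.differentiable (by simp) s).hasDerivAt
  have hq : √s ≠ 0 := by rw [Real.sqrt_ne_zero']; exact hs
  have h2 := ((Real.hasDerivAt_sqrt hs.ne').inv hq).pow N
  have h3 : deriv (profile N) s = _ := (h1.mul h2).deriv
  rw [h3]
  have e : √s ^ 2 = s := Real.sq_sqrt hs.le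
  rcases N with _ | n
  · simp [profile]
  · simp only [profile, Pi.inv_apply, Pi.pow_apply, Nat.add_sub_cancel]
    rw [pow_succ, ← e]
    have : √(√s ^ 2) = √s := by rw [e]
    rw [this]
    field_simp
    push_cast
    ring

lemma profile_four_mul (N : ℕ) (s : ℝ) :
    2 ^ N * profile N (4 * s) = step (4 * s) * (√s)⁻¹ ^ N := by
  have : √(4 * s) = 2 * √s := by
    rw [Real.sqrt_mul (by norm_num), show (4 : ℝ) = 2 ^ 2 by norm_num,
      Real.sqrt_sq (by norm_num)]
  rw [profile, this, mul_inv, mul_pow, inv_pow]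
  field_simp

/-- The Laplacian of `x ↦ ∫ profile` as a function of `‖x‖²`. -/
def profileLap (N : ℕ) (s : ℝ) : ℝ := 4 * s * deriv (profile N) s + 2 * N * profile N s

lemma contDiff_profileLap (N : ℕ) : ContDiff ℝ ∞ (profileLap N) := by
  have h1 : ContDiff ℝ ∞ (deriv (profile N)) := by
    have := contDiff_profile N
    rw [contDiff_infty_iff_deriv] at this
    exact this.2
  have h2 := contDiff_profile N
  unfold profileLap
  fun_prop

lemma deriv_step_nonneg (s : ℝ) : 0 ≤ deriv step s := step_mono.deriv_nonneg

lemma profileLap_nonneg (N : ℕ) {s : ℝ} (hs : 0 ≤ s) : 0 ≤ profileLap N s := by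
  rcases hs.eq_or_lt with rfl | hs
  · simp [profileLap, profile, step_eq_zero]
  · rw [profileLap, deriv_profile N hs]
    have := deriv_step_nonneg s
    positivity

lemma profileLap_eq_zero (N : ℕ) {s : ℝ} (hs : 1 < s) : profileLap N s = 0 := by
  rw [profileLap, deriv_profile N (by linarith)]
  have : deriv step s = 0 := by
    have h : step =ᶠ[𝓝 s] fun _ => 1 := by
      filter_upwards [Ioi_mem_nhds hs] with a ha using step_eq_one (le_of_lt ha)
    rw [h.deriv_eq]
    simp
  rw [this]
  ring

lemma exists_profileLap_pos (N : ℕ) : ∃ s, 0 < s ∧ 0 < profileLap N s := by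
  obtain ⟨s, hs, h⟩ := exists_deriv_eq_slope step (a := 1 / 4) (b := 1) (by norm_num)
    contDiff_step.continuous.continuousOn
    (contDiff_step.differentiable (by simp)).differentiableOn
  have hs0 : 0 < s := by linarith [hs.1]
  refine ⟨s, hs0, ?_⟩
  rw [profileLap, deriv_profile N hs0, h, step_eq_one le_rfl, step_eq_zero le_rfl]
  norm_num
  positivity

/-- The derivative of the profile of the potential kernel. -/
def potDeriv (N : ℕ) (s : ℝ) : ℝ := profile N s - 2 ^ N * profile N (4 * s)

lemma potDeriv_eq (N : ℕ) (s : ℝ) :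
    potDeriv N s = (step s - step (4 * s)) * (√s)⁻¹ ^ N := by
  rw [potDeriv, profile_four_mul, profile]
  ring

lemma contDiff_potDeriv (N : ℕ) : ContDiff ℝ ∞ (potDeriv N) := by
  have h := contDiff_profile N
  unfold potDeriv
  exact h.sub (contDiff_const.mul (h.comp (by fun_prop)))

lemma hasDerivAt_potDeriv (N : ℕ) (s : ℝ) : HasDerivAt (potDeriv N)
    (deriv (profile N) s - 2 ^ N * (4 * deriv (profile N) (4 * s))) s := by
  have h : ∀ s, HasDerivAt (profile N) (deriv (profile N) s) s := fun s =>
    ((contDiff_profile N).differentiable (by simp) s).hasDerivAt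
  have h4 : HasDerivAt (fun s : ℝ => 4 * s) 4 s := by
    simpa using (hasDerivAt_id s).const_mul (4 : ℝ)
  have := (h s).sub (((h (4 * s)).comp s h4).const_mul (2 ^ N))
  exact this.congr_deriv (by ring)

/-- The profile of the potential kernel. -/
def pot (N : ℕ) (s : ℝ) : ℝ := ∫ τ in (1 : ℝ)..s, potDeriv N τ

lemma hasDerivAt_pot (N : ℕ) (s : ℝ) : HasDerivAt (pot N) (potDeriv N s) s :=
  intervalIntegral.integral_hasDerivAt_right
    ((contDiff_potDeriv N).continuous.intervalIntegrable _ _)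
    ((contDiff_potDeriv N).continuous.stronglyMeasurableAtFilter _ _)
    (contDiff_potDeriv N).continuous.continuousAt

lemma contDiff_pot (N : ℕ) : ContDiff ℝ ∞ (pot N) := by
  rw [contDiff_infty_iff_deriv]
  refine ⟨fun s => (hasDerivAt_pot N s).differentiableAt, ?_⟩
  rw [show deriv (pot N) = potDeriv N from funext fun s => (hasDerivAt_pot N s).deriv]
  exact contDiff_potDeriv N

lemma pot_eq_zero (N : ℕ) {s : ℝ} (hs : 1 ≤ s) : pot N s = 0 := by
  refine intervalIntegral.integral_zero_ae (Eventually.of_forall fun τ hτ => ?_)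
  rw [uIoc_of_le hs] at hτ
  rw [potDeriv_eq, step_eq_one hτ.1.le, step_eq_one (by linarith [hτ.1])]
  ring

lemma pot_nonneg (N : ℕ) {s : ℝ} (hs : 0 ≤ s) : 0 ≤ pot N s := by
  rcases le_or_gt 1 s with h | h
  · rw [pot_eq_zero N h]
  · rw [pot, intervalIntegral.integral_symm, ← intervalIntegral.integral_neg]
    refine intervalIntegral.integral_nonneg h.le fun τ hτ => ?_
    rw [potDeriv_eq]
    have : step τ ≤ step (4 * τ) := step_mono (by linarith [hτ.1])
    have h2 : (0 : ℝ) ≤ (√τ)⁻¹ ^ N := by positivity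
    nlinarith

/-- A smooth radial mollifier `η` and a potential `ψ` with `Δψ = η - 2 ^ N η(2 ·)`. -/
structure KernelPair (N : ℕ) where
  η : (𝔼 N) → ℝ
  ψ : (𝔼 N) → ℝ
  testη : IsTest 1 η
  testψ : IsTest 1 ψ
  lapψ : ∀ y, lap N ψ y = η y - 2 ^ N * η ((2 : ℝ) • y)
  η_nonneg : ∀ y, 0 ≤ η y
  ψ_nonneg : ∀ y, 0 ≤ ψ y
  η_neg : ∀ y, η (-y) = η y
  integralη : ∫ y, η y = 1

lemma KernelPair.integral_psi_pos (K : KernelPair N) (hN : N ≠ 0) : 0 < ∫ y, K.ψ y := by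
  by_contra hcon
  have h0 : K.ψ = 0 := by
    ext x
    by_contra hx
    exact hcon (K.testψ.continuous.integral_pos_of_hasCompactSupport_nonneg_nonzero
      K.testψ.hasCompactSupport K.ψ_nonneg hx)
  have hη : ∀ y, K.η y = 2 ^ N * K.η ((2 : ℝ) • y) := by
    intro y
    have h1 := K.lapψ y
    have h2 : lap N K.ψ y = 0 := by
      rw [h0, lap_eq_sum]
      have : ∀ v : 𝔼 N, dd v (0 : (𝔼 N) → ℝ) = 0 := fun v => by ext; simp [dd]
      simp [this]
    linarith
  have key : ∀ n : ℕ, ∀ y, 1 < 2 ^ n * ‖y‖ → K.η y = 0 := by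
    intro n
    induction n with
    | zero => intro y hy; exact K.testη.eq_zero (by simpa using hy)
    | succ n ih =>
      intro y hy
      rw [hη, ih, mul_zero]
      rw [norm_smul, Real.norm_ofNat]
      rw [pow_succ] at hy
      linarith
  have hz : ∀ y, K.η y = 0 := by
    intro y
    by_cases hy : y = 0
    · have h1 := hη 0
      rw [smul_zero] at h1
      have h2 : (2 : ℝ) ≤ 2 ^ N := by
        calc (2 : ℝ) = 2 ^ 1 := (pow_one _).symm
          _ ≤ 2 ^ N := pow_le_pow_right₀ (by norm_num) (Nat.one_le_iff_ne_zero.2 hN)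
      have h3 := K.η_nonneg 0
      rw [hy]
      nlinarith
    · obtain ⟨n, hn⟩ := pow_unbounded_of_one_lt (‖y‖⁻¹) (by norm_num : (1 : ℝ) < 2)
      refine key n y ?_
      have := norm_pos_iff.2 hy
      rwa [inv_lt_iff_one_lt_mul₀ this] at hn
  have := K.integralη
  simp [hz] at this

theorem exists_kernelPair (hN : 0 < N) : Nonempty (KernelPair N) := by
  have hsm : ContDiff ℝ ∞ fun x : 𝔼 N => ‖x‖ ^ 2 := contDiff_norm_sq ℝ
  have sq1 : ∀ x : 𝔼 N, 1 < ‖x‖ → 1 < ‖x‖ ^ 2 := fun x hx => by nlinarith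
  let η : (𝔼 N) → ℝ := fun x => profileLap N (‖x‖ ^ 2)
  let ψ : (𝔼 N) → ℝ := fun x => pot N (‖x‖ ^ 2)
  have tη : IsTest 1 η := .of_eq_zero ((contDiff_profileLap N).comp hsm)
    fun x hx => profileLap_eq_zero N (sq1 x hx)
  have tψ : IsTest 1 ψ := .of_eq_zero ((contDiff_pot N).comp hsm)
    fun x hx => pot_eq_zero N (sq1 x hx).le
  have ηnn : ∀ x, 0 ≤ η x := fun x => profileLap_nonneg N (sq_nonneg _)
  have hl : ∀ x, lap N ψ x = η x - 2 ^ N * η ((2 : ℝ) • x) := by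
    intro x
    have h := lap_radial (hasDerivAt_pot N) (hasDerivAt_potDeriv N) x
    simp only [ψ, η, h, profileLap, norm_smul, potDeriv]
    rw [show (‖(2 : ℝ)‖ * ‖x‖) ^ 2 = 4 * ‖x‖ ^ 2 by rw [Real.norm_ofNat]; ring]
    ring
  have hpos : 0 < ∫ x, η x := by
    obtain ⟨s, hs, hs'⟩ := exists_profileLap_pos N
    refine tη.continuous.integral_pos_of_hasCompactSupport_nonneg_nonzero
      tη.hasCompactSupport ηnn (x := EuclideanSpace.single ⟨0, hN⟩ (√s)) ?_
    simp only [η, PiLp.norm_single, Real.norm_eq_abs, sq_abs, Real.sq_sqrt hs.le]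
    exact hs'.ne'
  set c := (∫ x, η x)⁻¹ with hc
  have hc0 : 0 < c := inv_pos.2 hpos
  exact ⟨{
    η := fun x => c * η x
    ψ := fun x => c * ψ x
    testη := .of_eq_zero (contDiff_const.mul tη.1) fun x hx => by rw [tη.eq_zero hx, mul_zero]
    testψ := .of_eq_zero (contDiff_const.mul tψ.1) fun x hx => by rw [tψ.eq_zero hx, mul_zero]
    lapψ := fun y => by rw [lap_const_mul tψ.1, hl]; ring
    η_nonneg := fun y => mul_nonneg hc0.le (ηnn y)
    ψ_nonneg := fun y => mul_nonneg hc0.le (pot_nonneg N (sq_nonneg _))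
    η_neg := fun y => by simp [η]
    integralη := by rw [integral_const_mul, hc, inv_mul_cancel₀ hpos.ne'] }⟩

end

section

/-! ### Kernel bounds -/

namespace IsTest

variable {R : ℝ} {φ : (𝔼 N) → ℝ}

lemma exists_dd_le (h : IsTest R φ) : ∃ C, 0 ≤ C ∧ ∀ v x, |dd v φ x| ≤ C * ‖v‖ := by
  choose C hC0 hC using fun i : Fin N => (h.dir (EuclideanSpace.single i 1)).exists_bound
  refine ⟨∑ i, C i, Finset.sum_nonneg fun i _ => hC0 i, fun v x => ?_⟩
  rw [dd_eq_sum, Finset.sum_mul]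
  refine (Finset.abs_sum_le_sum_abs _ _).trans (Finset.sum_le_sum fun i _ => ?_)
  rw [abs_mul, mul_comm]
  exact mul_le_mul (hC i x) (PiLp.norm_apply_le v i) (abs_nonneg _) (hC0 i)

lemma exists_dd_dd_le (h : IsTest R φ) :
    ∃ C, 0 ≤ C ∧ ∀ v x, |dd v (dd v φ) x| ≤ C * ‖v‖ ^ 2 := by
  choose C hC0 hC using fun i : Fin N => (h.dir (EuclideanSpace.single i 1)).exists_dd_le
  refine ⟨∑ i, C i, Finset.sum_nonneg fun i _ => hC0 i, fun v x => ?_⟩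
  rw [dd_eq_sum, Finset.sum_mul]
  refine (Finset.abs_sum_le_sum_abs _ _).trans (Finset.sum_le_sum fun i _ => ?_)
  rw [abs_mul, dd_comm h.1]
  calc |v i| * |dd v (dd (EuclideanSpace.single i 1) φ) x| ≤ ‖v‖ * (C i * ‖v‖) :=
        mul_le_mul (PiLp.norm_apply_le v i) (hC i v x) (abs_nonneg _) (norm_nonneg _)
    _ = C i * ‖v‖ ^ 2 := by ring

lemma exists_dd_dd_dd_le (h : IsTest R φ) :
    ∃ C, 0 ≤ C ∧ ∀ v x, |dd v (dd v (dd v φ)) x| ≤ C * ‖v‖ ^ 3 := by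
  choose C hC0 hC using fun i : Fin N => (h.dir (EuclideanSpace.single i 1)).exists_dd_dd_le
  refine ⟨∑ i, C i, Finset.sum_nonneg fun i _ => hC0 i, fun v x => ?_⟩
  rw [dd_eq_sum, Finset.sum_mul]
  refine (Finset.abs_sum_le_sum_abs _ _).trans (Finset.sum_le_sum fun i _ => ?_)
  rw [abs_mul, dd_comm (h.1.dir v), dd_comm h.1]
  calc |v i| * |dd v (dd v (dd (EuclideanSpace.single i 1) φ)) x| ≤ ‖v‖ * (C i * ‖v‖ ^ 2) :=
        mul_le_mul (PiLp.norm_apply_le v i) (hC i v x) (abs_nonneg _) (norm_nonneg _)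
    _ = C i * ‖v‖ ^ 3 := by ring

lemma comp_sub (h : IsTest R φ) (σ : 𝔼 N) : IsTest (R + ‖σ‖) (fun y => φ (y - σ)) := by
  refine of_eq_zero (h.1.comp (by fun_prop)) fun x hx => h.eq_zero ?_
  have := norm_sub_norm_le x σ
  linarith

lemma comp_smul (h : IsTest R φ) {c : ℝ} (hc : 1 ≤ c) (hR : 0 ≤ R) :
    IsTest R (fun y => φ (c • y)) := by
  refine of_eq_zero (h.1.comp (by fun_prop)) fun x hx => h.eq_zero ?_
  rw [norm_smul, Real.norm_of_nonneg (by linarith)]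
  nlinarith [norm_nonneg x]

lemma mono {R' : ℝ} (h : IsTest R φ) (hR : R ≤ R') : IsTest R' φ :=
  ⟨h.1, h.2.trans (closedBall_subset_closedBall hR)⟩

lemma add {ψ : (𝔼 N) → ℝ} (h : IsTest R φ) (h' : IsTest R ψ) :
    IsTest R (fun y => φ y + ψ y) :=
  of_eq_zero (h.1.add h'.1) fun x hx => by simp [h.eq_zero hx, h'.eq_zero hx]

lemma sub {ψ : (𝔼 N) → ℝ} (h : IsTest R φ) (h' : IsTest R ψ) :
    IsTest R (fun y => φ y - ψ y) :=
  of_eq_zero (h.1.sub h'.1) fun x hx => by simp [h.eq_zero hx, h'.eq_zero hx]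

lemma const_mul (h : IsTest R φ) (c : ℝ) : IsTest R (fun y => c * φ y) :=
  of_eq_zero (contDiff_const.mul h.1) fun x hx => by simp [h.eq_zero hx]

end IsTest

lemma hasDerivAt_line {φ : (𝔼 N) → ℝ} (h : ContDiff ℝ ∞ φ) (y σ : 𝔼 N) (s : ℝ) :
    HasDerivAt (fun s : ℝ => φ (y - s • σ)) (- dd σ φ (y - s • σ)) s := by
  have h1 : HasDerivAt (fun s : ℝ => y - s • σ) (- ((1 : ℝ) • σ)) s :=
    ((hasDerivAt_id s).smul_const σ).const_sub y
  have := (h.differentiable (by simp) (y - s • σ)).hasFDerivAt.comp_hasDerivAt s h1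
  rw [one_smul, map_neg] at this
  exact this

lemma lap_add {φ ψ : (𝔼 N) → ℝ} (hφ : ContDiff ℝ ∞ φ) (hψ : ContDiff ℝ ∞ ψ) :
    lap N (fun x => φ x + ψ x) = fun x => lap N φ x + lap N ψ x := by
  ext x
  simp only [lap_eq_sum, ← Finset.sum_add_distrib]
  refine Finset.sum_congr rfl fun i _ => ?_
  rw [dd_add hφ hψ, dd_add (hφ.dir _) (hψ.dir _)]

lemma lap_sub {φ ψ : (𝔼 N) → ℝ} (hφ : ContDiff ℝ ∞ φ) (hψ : ContDiff ℝ ∞ ψ) :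
    lap N (fun x => φ x - ψ x) = fun x => lap N φ x - lap N ψ x := by
  ext x
  simp only [lap_eq_sum, ← Finset.sum_sub_distrib]
  refine Finset.sum_congr rfl fun i _ => ?_
  rw [dd_sub hφ hψ, dd_sub (hφ.dir _) (hψ.dir _)]

/-- The second order Taylor remainder of the translate `φ (· - σ)`. -/
def taylorRem (σ : 𝔼 N) (φ : (𝔼 N) → ℝ) : (𝔼 N) → ℝ :=
  fun y => φ (y - σ) - φ y + dd σ φ y - 1 / 2 * dd σ (dd σ φ) y

lemma abs_image_one_le {r r' : ℝ → ℝ} {C : ℝ} (hr : ∀ s, HasDerivAt r (r' s) s)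
    (h0 : r 0 = 0) (hC : ∀ s ∈ Icc (0 : ℝ) 1, |r' s| ≤ C) : ∀ s ∈ Icc (0 : ℝ) 1, |r s| ≤ C := by
  intro s hs
  have := norm_image_sub_le_of_norm_deriv_le_segment' (a := 0) (b := 1) (f := r) (f' := r') (C := C)
    (fun x _ => (hr x).hasDerivWithinAt) (fun x hx => hC x (Ico_subset_Icc_self hx)) s hs
  rw [h0, sub_zero, sub_zero, Real.norm_eq_abs] at this
  have hC0 : 0 ≤ C := (abs_nonneg _).trans (hC 0 (by simp))
  exact this.trans (mul_le_of_le_one_right hC0 hs.2)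

namespace IsTest

variable {R : ℝ} {φ : (𝔼 N) → ℝ}

lemma exists_dd_dd_sub_le (h : IsTest R φ) :
    ∃ C, 0 ≤ C ∧ ∀ v σ y, |dd v (dd v φ) (y - σ) - dd v (dd v φ) y| ≤ C * ‖v‖ ^ 2 * ‖σ‖ := by
  choose C hC0 hC using fun i : Fin N => (h.dir (EuclideanSpace.single i 1)).exists_dd_dd_le
  refine ⟨∑ i, C i, Finset.sum_nonneg fun i _ => hC0 i, fun v σ y => ?_⟩
  have hb : ∀ x, |dd σ (dd v (dd v φ)) x| ≤ (∑ i, C i) * ‖v‖ ^ 2 * ‖σ‖ := fun x => by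
    rw [dd_eq_sum, Finset.sum_mul, Finset.sum_mul]
    refine (Finset.abs_sum_le_sum_abs _ _).trans (Finset.sum_le_sum fun i _ => ?_)
    rw [abs_mul, dd_comm (h.1.dir v), dd_comm h.1]
    calc |σ i| * |dd v (dd v (dd (EuclideanSpace.single i 1) φ)) x| ≤ ‖σ‖ * (C i * ‖v‖ ^ 2) :=
          mul_le_mul (PiLp.norm_apply_le σ i) (hC i v x) (abs_nonneg _) (norm_nonneg _)
      _ = C i * ‖v‖ ^ 2 * ‖σ‖ := by ring
  have := abs_image_one_le (r := fun s : ℝ => dd v (dd v φ) (y - s • σ) - dd v (dd v φ) y)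
    (fun s => (hasDerivAt_line ((h.1.dir v).dir v) y σ s).sub_const _) (by simp)
    (fun s _ => by rw [abs_neg]; exact hb _) 1 (by simp)
  simpa using this

lemma exists_taylorRem_le (h : IsTest R φ) :
    ∃ C, 0 ≤ C ∧ ∀ σ y, |taylorRem σ φ y| ≤ C * ‖σ‖ ^ 3 := by
  obtain ⟨C, hC0, hC⟩ := h.exists_dd_dd_dd_le
  refine ⟨C, hC0, fun σ y => ?_⟩
  have h2 := abs_image_one_le (r := fun s : ℝ => dd σ (dd σ φ) (y - s • σ) - dd σ (dd σ φ) y)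
    (fun s => (hasDerivAt_line ((h.1.dir σ).dir σ) y σ s).sub_const _) (by simp) (C := C * ‖σ‖ ^ 3)
    (fun s _ => by rw [abs_neg]; exact hC σ _)
  have h1 := abs_image_one_le
    (r := fun s : ℝ => dd σ φ (y - s • σ) - dd σ φ y + s * dd σ (dd σ φ) y)
    (r' := fun s => - dd σ (dd σ φ) (y - s • σ) + 1 * dd σ (dd σ φ) y)
    (fun s => ((hasDerivAt_line (h.1.dir σ) y σ s).sub_const _).add
      ((hasDerivAt_id s).mul_const _)) (by simp) (C := C * ‖σ‖ ^ 3)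
    (fun s hs => by
      have := h2 s hs
      rw [abs_sub_comm] at this
      convert this using 2
      ring)
  have h0 := abs_image_one_le
    (r := fun s : ℝ => φ (y - s • σ) - φ y + s * dd σ φ y - s ^ 2 * (1 / 2 * dd σ (dd σ φ) y))
    (r' := fun s => - dd σ φ (y - s • σ) + 1 * dd σ φ y
      - (2 : ℕ) * s ^ 1 * (1 / 2 * dd σ (dd σ φ) y))
    (fun s => (((hasDerivAt_line h.1 y σ s).sub_const _).add
      ((hasDerivAt_id s).mul_const _)).sub ((hasDerivAt_pow 2 s).mul_const _))
    (by simp) (C := C * ‖σ‖ ^ 3)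
    (fun s hs => by
      have := h1 s hs
      rw [← abs_neg] at this
      convert this using 2
      push_cast
      ring) 1 (by simp)
  simpa [taylorRem] using h0

lemma taylorRem (h : IsTest R φ) {σ : 𝔼 N} (hσ : ‖σ‖ ≤ 1) :
    IsTest (R + 1) (taylorRem σ φ) :=
  ((((h.comp_sub σ).mono (by linarith)).sub (h.mono (by linarith))).add
    ((h.dir σ).mono (by linarith))).sub ((((h.dir σ).dir σ).mono (by linarith)).const_mul _)

end IsTest

lemma lap_comp_sub {φ : (𝔼 N) → ℝ} (hφ : ContDiff ℝ ∞ φ) (σ : 𝔼 N) :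
    lap N (fun y => φ (y - σ)) = fun y => lap N φ (y - σ) := by
  ext y
  have := lap_comp_affine hφ (-σ) 1 y
  simpa [neg_add_eq_sub] using this

lemma lap_taylorRem {φ : (𝔼 N) → ℝ} (h : ContDiff ℝ ∞ φ) (σ : 𝔼 N) :
    lap N (taylorRem σ φ) = taylorRem σ (lap N φ) := by
  have hs : ContDiff ℝ ∞ fun y => φ (y - σ) := h.comp (by fun_prop)
  unfold taylorRem
  rw [lap_sub ((hs.sub h).add (h.dir σ)) (contDiff_const.mul ((h.dir σ).dir σ)),
    lap_add (hs.sub h) (h.dir σ), lap_sub hs h, lap_comp_sub h, lap_dd h]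
  ext y
  rw [lap_const_mul ((h.dir σ).dir σ), lap_dd (h.dir σ), lap_dd h]

lemma dd_smul_vec (φ : (𝔼 N) → ℝ) (c : ℝ) (v : 𝔼 N) :
    dd (c • v) φ = fun x => c * dd v φ x := by
  ext x
  simp [dd]

lemma dd_dd_smul_vec {φ : (𝔼 N) → ℝ} (h : ContDiff ℝ ∞ φ) (c : ℝ) (v : 𝔼 N) :
    dd (c • v) (dd (c • v) φ) = fun x => c ^ 2 * dd v (dd v φ) x := by
  rw [dd_smul_vec, dd_smul_vec, dd_const_mul (h.dir v)]
  ext x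
  ring

/-- A dilation of scale two acts on kernels as `φ ↦ φ - c φ(2 ·)`. -/
lemma dd_two_scale {φ : (𝔼 N) → ℝ} (h : ContDiff ℝ ∞ φ) (c : ℝ) (v : 𝔼 N) :
    dd v (fun y => φ y - c * φ ((2 : ℝ) • y)) =
      fun y => dd v φ y - c * 2 * dd v φ ((2 : ℝ) • y) := by
  have h2 : ContDiff ℝ ∞ fun y => φ ((2 : ℝ) • y) := h.comp (by fun_prop)
  have := dd_comp_affine h 0 2 v
  simp only [zero_add] at this
  rw [dd_sub h (contDiff_const.mul h2), dd_const_mul h2, this]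
  ext y
  ring

lemma taylorRem_two_scale {φ : (𝔼 N) → ℝ} (h : ContDiff ℝ ∞ φ) (c : ℝ) (σ : 𝔼 N) :
    taylorRem σ (fun y => φ y - c * φ ((2 : ℝ) • y)) =
      fun y => taylorRem σ φ y - c * taylorRem ((2 : ℝ) • σ) φ ((2 : ℝ) • y) := by
  ext y
  unfold taylorRem
  rw [dd_two_scale h, dd_two_scale (h.dir σ), dd_dd_smul_vec h, dd_smul_vec]
  simp only [smul_sub]
  ring

end

section

/-! ### Pairing a function with a rescaled kernel -/

/-- The average of `f` around `x` at scale `t` against the kernel `K`. -/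
def pair (f : (𝔼 N) → ℝ) (t : ℝ) (x : 𝔼 N) (K : (𝔼 N) → ℝ) : ℝ :=
  ∫ y, f (x + t • y) * K y

/-- Measurable functions bounded by `B`. -/
def BddMeas (B : ℝ) (f : (𝔼 N) → ℝ) : Prop := Measurable f ∧ ∀ x, |f x| ≤ B

/-- The volume of the closed ball of radius `R`. -/
def ballVol (N : ℕ) (R : ℝ) : ℝ := volume.real (closedBall (0 : 𝔼 N) R)

lemma ballVol_nonneg (N : ℕ) (R : ℝ) : 0 ≤ ballVol N R := measureReal_nonneg

section pair

variable {f : (𝔼 N) → ℝ} {B R : ℝ} {K K' : (𝔼 N) → ℝ} {t : ℝ} {x : 𝔼 N}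

lemma BddMeas.integrable (hf : BddMeas B f) (hK : Integrable K) (t : ℝ) (x : 𝔼 N) :
    Integrable fun y => f (x + t • y) * K y :=
  hK.bdd_mul (hf.1.comp (by fun_prop)).aestronglyMeasurable
    (ae_of_all _ fun y => (Real.norm_eq_abs _).trans_le (hf.2 _))

lemma pair_sub (hf : BddMeas B f) (hK : Integrable K) (hK' : Integrable K') :
    pair f t x (fun y => K y - K' y) = pair f t x K - pair f t x K' := by
  unfold pair
  rw [← integral_sub (hf.integrable hK t x) (hf.integrable hK' t x)]
  simp only [mul_sub]

lemma pair_add (hf : BddMeas B f) (hK : Integrable K) (hK' : Integrable K') :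
    pair f t x (fun y => K y + K' y) = pair f t x K + pair f t x K' := by
  unfold pair
  rw [← integral_add (hf.integrable hK t x) (hf.integrable hK' t x)]
  simp only [mul_add]

lemma pair_const_mul (c : ℝ) : pair f t x (fun y => c * K y) = c * pair f t x K := by
  unfold pair
  rw [← integral_const_mul]
  congr 1
  ext y
  ring

lemma pair_half (f : (𝔼 N) → ℝ) (t : ℝ) (x : 𝔼 N) (K : (𝔼 N) → ℝ) :
    pair f t x (fun y => 2 ^ N * K ((2 : ℝ) • y)) = pair f (t / 2) x K := by
  have := Measure.integral_comp_smul (volume : Measure (𝔼 N))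
    (fun y => f (x + (t / 2) • y) * K y) (2 : ℝ)
  rw [finrank_euclideanSpace, Fintype.card_fin, abs_of_pos (by positivity), smul_eq_mul] at this
  rw [pair_const_mul, pair, pair, ← mul_right_inj' (a := ((2 : ℝ) ^ N)⁻¹) (by positivity), ← this,
    inv_mul_cancel_left₀ (by positivity)]
  simp only [smul_smul]
  norm_num

lemma pair_shift (f : (𝔼 N) → ℝ) (ht : t ≠ 0) (x v : 𝔼 N) (K : (𝔼 N) → ℝ) :
    pair f t (x + v) K = pair f t x fun y => K (y - t⁻¹ • v) := by
  unfold pair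
  rw [← integral_sub_right_eq_self _ (t⁻¹ • v)]
  congr 1
  ext y
  rw [smul_sub, smul_inv_smul₀ ht, add_add_sub_cancel]

lemma abs_pair_le_integral (hf : BddMeas B f) (hK : IsTest R K) {b : ℝ}
    (hb : ∀ y, ‖y‖ ≤ R → |f (x + t • y)| ≤ b) : |pair f t x K| ≤ b * ∫ y, |K y| := by
  rw [← integral_const_mul]
  refine (abs_integral_le_integral_abs).trans ?_
  refine integral_mono (hf.integrable hK.integrable t x).abs (hK.integrable.abs.const_mul _)
    fun y => ?_
  simp only [abs_mul]
  by_cases hy : ‖y‖ ≤ R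
  · exact mul_le_mul_of_nonneg_right (hb y hy) (abs_nonneg _)
  · simp [hK.eq_zero (not_le.1 hy)]

lemma IsTest.integral_abs_le (hK : IsTest R K) {C : ℝ} (hC : ∀ y, |K y| ≤ C) :
    ∫ y, |K y| ≤ C * ballVol N R := by
  have h1 : ∫ y, |K y| = ∫ y in closedBall (0 : 𝔼 N) R, |K y| := by
    rw [setIntegral_eq_integral_of_forall_compl_eq_zero]
    intro y hy
    simp only [mem_closedBall, dist_zero_right, not_le] at hy
    rw [hK.eq_zero hy, abs_zero]
  have h2 := norm_setIntegral_le_of_norm_le_const (μ := volume) (f := fun y => |K y|)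
    (s := closedBall (0 : 𝔼 N) R) (C := C) measure_closedBall_lt_top
    (fun y _ => by simpa using hC y)
  rw [h1]
  exact (le_abs_self _).trans h2

lemma abs_pair_le (hf : BddMeas B f) (hK : IsTest R K) {b C : ℝ} (hb0 : 0 ≤ b)
    (hb : ∀ y, ‖y‖ ≤ R → |f (x + t • y)| ≤ b) (hC : ∀ y, |K y| ≤ C) :
    |pair f t x K| ≤ b * (C * ballVol N R) :=
  (abs_pair_le_integral hf hK hb).trans (mul_le_mul_of_nonneg_left (hK.integral_abs_le hC) hb0)

/-- Averages are Lipschitz at their own scale. -/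
lemma abs_pair_add_sub_le (hf : BddMeas B f) (hB : 0 ≤ B) (hK : IsTest R K) {C : ℝ}
    (hC : ∀ σ y, |K (y - σ) - K y| ≤ C * ‖σ‖) (ht : 0 < t) {v : 𝔼 N} (hv : ‖v‖ ≤ t) :
    |pair f t (x + v) K - pair f t x K| ≤ B * (C * ballVol N (R + 1)) * (‖v‖ / t) := by
  have hn : ‖t⁻¹ • v‖ = ‖v‖ / t := by
    rw [norm_smul, norm_inv, Real.norm_of_nonneg ht.le, inv_mul_eq_div]
  have h1 : ‖t⁻¹ • v‖ ≤ 1 := by rw [hn]; exact div_le_one_of_le₀ hv ht.le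
  have hT := (hK.comp_sub (t⁻¹ • v)).mono (R' := R + 1) (by linarith)
  have hT' := hK.mono (R' := R + 1) (by linarith)
  rw [pair_shift f ht.ne', ← pair_sub hf hT.integrable hK.integrable]
  refine (abs_pair_le hf (hT.sub hT') hB (fun y _ => hf.2 _) (hC _)).trans_eq ?_
  rw [hn]
  ring

lemma pair_taylorRem (hf : BddMeas B f) (hK : IsTest R K) (σ : 𝔼 N) :
    pair f t x (taylorRem σ K) = pair f t x (fun y => K (y - σ)) - pair f t x K +
      pair f t x (dd σ K) - 1 / 2 * pair f t x (dd σ (dd σ K)) := by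
  have h1 := hK.comp_sub σ
  have h := hK.mono (R' := R + ‖σ‖) (by linarith [norm_nonneg σ])
  have h2 := h.dir σ
  have h3 := h2.dir σ
  unfold taylorRem
  rw [pair_sub hf ((h1.sub h).add h2).integrable (h3.const_mul _).integrable,
    pair_add hf (h1.sub h).integrable h2.integrable, pair_sub hf h1.integrable h.integrable,
    pair_const_mul]

lemma pair_eq (f : (𝔼 N) → ℝ) (ht : 0 < t) (x : 𝔼 N) (K : (𝔼 N) → ℝ) :
    pair f t x K = (t ^ N)⁻¹ * ∫ w, f w * K (t⁻¹ • (w - x)) := by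
  have := Measure.integral_comp_smul (volume : Measure (𝔼 N))
    (fun w => f (x + w) * K (t⁻¹ • w)) t
  rw [finrank_euclideanSpace, Fintype.card_fin, abs_of_pos (by positivity), smul_eq_mul] at this
  rw [pair]
  simp only [inv_smul_smul₀ ht.ne'] at this
  rw [this, ← integral_add_left_eq_self (fun w => f w * K (t⁻¹ • (w - x))) x]
  simp only [add_sub_cancel_left]

end pair

end

section

/-! ### Solutions -/

/-- The indicator function of a set. -/
def chi (A : Set (𝔼 N)) : (𝔼 N) → ℝ := A.indicator fun _ => 1

lemma chi_nonneg (A : Set (𝔼 N)) (x : 𝔼 N) : 0 ≤ chi A x :=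
  indicator_nonneg (fun _ _ => zero_le_one) x

lemma chi_le_one (A : Set (𝔼 N)) (x : 𝔼 N) : chi A x ≤ 1 :=
  indicator_le_self' (fun _ _ => zero_le_one) x

lemma bddMeas_chi {A : Set (𝔼 N)} (hA : MeasurableSet A) : BddMeas 1 (chi A) :=
  ⟨measurable_const.indicator hA, fun x => abs_le.2 ⟨by linarith [chi_nonneg A x], chi_le_one A x⟩⟩

/-- A bounded function solving `Δ u = χ_Ω` in the unit ball around `z`, with the equation tested
against rescaled kernels. -/
structure Sol (M : ℝ) (z : 𝔼 N) (Ω : Set (𝔼 N)) (u : (𝔼 N) → ℝ) : Prop where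
  isOpen : IsOpen Ω
  bdd : BddMeas M u
  diff : ∀ x ∈ ball z 1, DifferentiableAt ℝ u x
  weak : ∀ (R : ℝ) (φ : (𝔼 N) → ℝ) (t : ℝ) (x : 𝔼 N), IsTest R φ → 0 < t → dist x z + R * t < 1 →
    pair u t x (lap N φ) = t ^ 2 * pair (chi Ω) t x φ
  crit : ∀ x ∈ ball z 1, x ∉ Ω → u x = 0 ∧ fderiv ℝ u x = 0
  mem_closure : z ∈ closure Ω
  notMem : z ∉ Ω

lemma MemP.sol {M : ℝ} {z : 𝔼 N} {Ω : Set (𝔼 N)} {u : (𝔼 N) → ℝ} (hM : 0 ≤ M)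
    (h : MemP N 1 z M Ω u) : Sol M z Ω ((ball z 1).indicator u) := by
  obtain ⟨hΩ, hu, hweak, hcrit, hbd, hz⟩ := h
  have hev : ∀ x ∈ ball z 1, (ball z 1).indicator u =ᶠ[𝓝 x] u := fun x hx =>
    Filter.eventuallyEq_of_mem (isOpen_ball.mem_nhds hx) fun y hy => indicator_of_mem hy u
  refine ⟨hΩ, ⟨hu.continuous.measurable.indicator measurableSet_ball, fun x => ?_⟩, fun x hx => ?_,
    fun R φ t x hφ ht hR => ?_, fun x hx hxΩ => ?_, hz.1, fun hzΩ => hz.2 (by rwa [hΩ.interior_eq])⟩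
  · by_cases hx : x ∈ ball z 1
    · rw [indicator_of_mem hx]
      exact hbd x hx
    · rwa [indicator_of_notMem hx, abs_zero]
  · exact ((hu.differentiable (by simp)) x).congr_of_eventuallyEq (hev x hx)
  · have e : ∀ w : 𝔼 N, t⁻¹ • (w - x) = -(t⁻¹ • x) + t⁻¹ • w := fun w => by
      rw [smul_sub, neg_add_eq_sub]
    have hsupp : ∀ K, IsTest R K → ∀ w ∉ ball z 1, K (t⁻¹ • (w - x)) = 0 := fun K hK w hw => by
      refine hK.eq_zero ?_
      rw [norm_smul, norm_inv, Real.norm_of_nonneg ht.le, ← dist_eq_norm, inv_mul_eq_div,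
        lt_div_iff₀ ht]
      rw [mem_ball, not_lt] at hw
      linarith [dist_triangle w x z]
    have hts : tsupport (fun w => φ (t⁻¹ • (w - x))) ⊆ ball z 1 := by
      have h1 : tsupport (fun w => φ (t⁻¹ • (w - x))) ⊆ closedBall x (R * t) := by
        refine closure_minimal (fun w hw => ?_) isClosed_closedBall
        by_contra hne
        rw [mem_closedBall, not_le] at hne
        refine hw (hφ.eq_zero ?_)
        rwa [norm_smul, norm_inv, Real.norm_of_nonneg ht.le, ← dist_eq_norm, inv_mul_eq_div,
          lt_div_iff₀ ht]
      refine h1.trans fun w hw => ?_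
      rw [mem_closedBall] at hw
      rw [mem_ball]
      linarith [dist_triangle w x z]
    have key := hweak (fun w => φ (t⁻¹ • (w - x))) (hφ.1.comp (by fun_prop)) hts
    have hl : lap N (fun w => φ (t⁻¹ • (w - x))) =
        fun w => (t⁻¹) ^ 2 * lap N φ (t⁻¹ • (w - x)) := by
      ext w
      simp only [e]
      exact lap_comp_affine hφ.1 _ _ _
    rw [hl] at key
    rw [pair_eq _ ht, pair_eq _ ht]
    have h1 : ∫ w, (ball z 1).indicator u w * lap N φ (t⁻¹ • (w - x)) =
        t ^ 2 * ∫ w, u w * ((t⁻¹) ^ 2 * lap N φ (t⁻¹ • (w - x))) := by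
      rw [← integral_const_mul]
      congr 1
      ext w
      by_cases hw : w ∈ ball z 1
      · rw [indicator_of_mem hw]
        field_simp
      · rw [hsupp _ hφ.laplace w hw]
        simp
    have h2 : ∫ w, chi Ω w * φ (t⁻¹ • (w - x)) = ∫ w in Ω, φ (t⁻¹ • (w - x)) := by
      rw [← integral_indicator hΩ.measurableSet]
      congr 1
      ext w
      by_cases hw : w ∈ Ω <;> simp [chi, hw]
    rw [h1, h2, key]
    ring
  · obtain ⟨h0, hg⟩ := hcrit x ⟨hx, hxΩ⟩
    refine ⟨by rw [indicator_of_mem hx, h0], ?_⟩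
    rw [(hev x hx).fderiv_eq]
    simpa [gradient] using hg

namespace Sol

variable {M : ℝ} {z : 𝔼 N} {Ω : Set (𝔼 N)} {u : (𝔼 N) → ℝ}

lemma two_scale (S : Sol M z Ω u) {R t : ℝ} {x : 𝔼 N} {α α' β : (𝔼 N) → ℝ} (hα : IsTest R α)
    (hα' : IsTest R α') (hβ : IsTest R β) (hR : 0 ≤ R)
    (hl : lap N β = fun y => α y - 2 ^ N * α' ((2 : ℝ) • y)) (ht : 0 < t)
    (hx : dist x z + R * t < 1) :
    pair u t x α - pair u (t / 2) x α' = t ^ 2 * pair (chi Ω) t x β := by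
  rw [← S.weak R β t x hβ ht hx, hl, pair_sub S.bdd hα.integrable
    ((hα'.comp_smul one_le_two hR).const_mul _).integrable, pair_half]

lemma nonneg (S : Sol M z Ω u) : 0 ≤ M := (abs_nonneg _).trans (S.bdd.2 z)

lemma bdd_chi (S : Sol M z Ω u) : BddMeas 1 (chi Ω) := bddMeas_chi S.isOpen.measurableSet

end Sol

variable (K : KernelPair N)

lemma KernelPair.lap_eq : lap N K.ψ = fun y => K.η y - 2 ^ N * K.η ((2 : ℝ) • y) :=
  funext K.lapψ

lemma KernelPair.lap_dd_eq (v : 𝔼 N) : lap N (dd v K.ψ) =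
    fun y => dd v K.η y - 2 ^ N * (2 * dd v K.η ((2 : ℝ) • y)) := by
  rw [lap_dd K.testψ.1, K.lap_eq, dd_two_scale K.testη.1]
  simp only [mul_assoc]

lemma KernelPair.lap_dd_dd_eq (v : 𝔼 N) : lap N (dd v (dd v K.ψ)) =
    fun y => dd v (dd v K.η) y - 2 ^ N * (4 * dd v (dd v K.η) ((2 : ℝ) • y)) := by
  rw [lap_dd (K.testψ.1.dir v), lap_dd K.testψ.1, K.lap_eq, dd_two_scale K.testη.1,
    dd_two_scale (K.testη.1.dir v)]
  ext y
  ring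

lemma KernelPair.lap_taylorRem_eq (σ : 𝔼 N) : lap N (taylorRem σ K.ψ) =
    fun y => taylorRem σ K.η y - 2 ^ N * taylorRem ((2 : ℝ) • σ) K.η ((2 : ℝ) • y) := by
  rw [lap_taylorRem K.testψ.1, K.lap_eq, taylorRem_two_scale K.testη.1]

end

section

/-! ### Pointwise estimates at scale `2^{-k}` -/

/-- The dyadic scales `2^{-k} / 4`. -/
def scale (k : ℕ) : ℝ := 1 / 4 / 2 ^ k

lemma scale_pos (k : ℕ) : 0 < scale k := by unfold scale; positivity

lemma scale_succ (k : ℕ) : scale (k + 1) = scale k / 2 := by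
  unfold scale
  rw [pow_succ]
  field_simp

lemma scale_zero : scale 0 = 1 / 4 := by simp [scale]

lemma scale_le (k : ℕ) : scale k ≤ 1 / 4 :=
  div_le_self (by norm_num) (one_le_pow₀ one_le_two)

lemma abs_sub_le_of_telescope {a : ℕ → ℝ} {C l : ℝ}
    (h : ∀ k, |a k - a (k + 1)| ≤ C / 2 ^ k) (hl : Tendsto a atTop (𝓝 l)) :
    |a 0 - l| ≤ 2 * C :=
  dist_le_of_le_geometric_two_of_tendsto₀ (C := 2 * C) (f := a)
    (fun k => by rw [Real.dist_eq]; convert h k using 1; ring) hl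

lemma tendsto_scaled (t : ℝ) : Tendsto (fun k : ℕ => t / 2 ^ k) atTop (𝓝 0) := by
  have := (tendsto_pow_atTop_nhds_zero_of_lt_one (r := (1 / 2 : ℝ)) (by norm_num)
    (by norm_num)).const_mul t
  simpa [div_eq_mul_inv] using this

section

variable {f : (𝔼 N) → ℝ} {B R : ℝ} {Φ : (𝔼 N) → ℝ} {x : 𝔼 N}

lemma pair_sub_const (hf : BddMeas B f) (hΦ : IsTest R Φ) (c t : ℝ) (x : 𝔼 N) :
    pair (fun w => f w - c) t x Φ = pair f t x Φ - c * ∫ y, Φ y := by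
  unfold pair
  rw [← integral_const_mul, ← integral_sub (hf.integrable hΦ.integrable t x)
    (hΦ.integrable.const_mul c)]
  simp only [sub_mul]

lemma BddMeas.sub_const (hf : BddMeas B f) (c : ℝ) : BddMeas (B + |c|) (fun w => f w - c) :=
  ⟨hf.1.sub_const c, fun x => (abs_sub _ _).trans (by linarith [hf.2 x])⟩

lemma tendsto_pair (hf : BddMeas B f) (hΦ : IsTest 1 Φ) (hc : ContinuousAt f x) (t : ℝ)
    (ht : 0 < t) :
    Tendsto (fun k : ℕ => pair f (t / 2 ^ k) x Φ) atTop (𝓝 (f x * ∫ y, Φ y)) := by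
  rw [Metric.tendsto_atTop]
  intro ε hε
  have hI : 0 ≤ ∫ y, |Φ y| := integral_nonneg fun y => abs_nonneg _
  obtain ⟨δ, hδ, hfδ⟩ := Metric.continuousAt_iff.1 hc (ε / (1 + ∫ y, |Φ y|)) (by positivity)
  obtain ⟨n, hn⟩ := eventually_atTop.1 ((tendsto_scaled t).eventually (gt_mem_nhds hδ))
  refine ⟨n, fun k hk => ?_⟩
  rw [Real.dist_eq, ← pair_sub_const hf hΦ]
  refine (abs_pair_le_integral (hf.sub_const _) hΦ (b := ε / (1 + ∫ y, |Φ y|))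
    fun y hy => ?_).trans_lt ?_
  · have := hfδ (x := x + (t / 2 ^ k) • y) (by
      rw [dist_self_add_left, norm_smul, Real.norm_of_nonneg (by positivity)]
      exact (mul_le_of_le_one_right (by positivity) hy).trans_lt (hn k hk))
    exact this.le
  · rw [div_mul_eq_mul_div, div_lt_iff₀ (by positivity)]
    nlinarith

lemma tendsto_pair_of_fderiv (hf : BddMeas B f) (hΦ : IsTest 1 Φ) (h0 : f x = 0)
    (hd : HasFDerivAt f (0 : (𝔼 N) →L[ℝ] ℝ) x) (t : ℝ) (ht : 0 < t) :
    Tendsto (fun k : ℕ => 2 ^ k * pair f (t / 2 ^ k) x Φ) atTop (𝓝 0) := by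
  rw [Metric.tendsto_atTop]
  intro ε hε
  have hI : 0 ≤ ∫ y, |Φ y| := integral_nonneg fun y => abs_nonneg _
  set c := ε / (t * (1 + ∫ y, |Φ y|)) with hcdef
  have hcpos : 0 < c := by positivity
  have ho := hd.isLittleO.def hcpos
  obtain ⟨δ, hδ, hfδ⟩ := Metric.eventually_nhds_iff.1 ho
  obtain ⟨n, hn⟩ := eventually_atTop.1 ((tendsto_scaled t).eventually (gt_mem_nhds hδ))
  refine ⟨n, fun k hk => ?_⟩
  rw [Real.dist_eq, sub_zero, abs_mul, abs_of_pos (by positivity)]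
  have key := abs_pair_le_integral hf hΦ (x := x) (t := t / 2 ^ k) (b := c * (t / 2 ^ k))
    fun y hy => by
      have hny : ‖(t / 2 ^ k) • y‖ ≤ t / 2 ^ k := by
        rw [norm_smul, Real.norm_of_nonneg (by positivity)]
        exact mul_le_of_le_one_right (by positivity) hy
      have := hfδ (y := x + (t / 2 ^ k) • y) (by
        rw [dist_self_add_left]
        exact hny.trans_lt (hn k hk))
      rw [h0, add_sub_cancel_left] at this
      simp only [_root_.zero_apply, sub_zero, Real.norm_eq_abs] at this
      exact this.trans (mul_le_mul_of_nonneg_left hny hcpos.le)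
  calc 2 ^ k * |pair f (t / 2 ^ k) x Φ| ≤ 2 ^ k * (c * (t / 2 ^ k) * ∫ y, |Φ y|) := by gcongr
    _ = c * t * ∫ y, |Φ y| := by field_simp
    _ < ε := by
      rw [hcdef, div_mul_eq_mul_div, div_mul_eq_mul_div, div_lt_iff₀ (by positivity)]
      nlinarith [mul_pos hε ht]

end

namespace Sol

variable {M : ℝ} {z : 𝔼 N} {Ω : Set (𝔼 N)} {u : (𝔼 N) → ℝ} (K : KernelPair N)

lemma abs_sub_avg_le (S : Sol M z Ω u) {t : ℝ} (ht : 0 < t) {x : 𝔼 N} (hx : dist x z + t < 1) :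
    |u x - pair u t x K.η| ≤ 2 * (∫ y, |K.ψ y|) * t ^ 2 := by
  have hxb : x ∈ ball z 1 := by rw [mem_ball]; linarith
  have hl := tendsto_pair S.bdd K.testη (S.diff x hxb).continuousAt t ht
  rw [K.integralη, mul_one] at hl
  have := abs_sub_le_of_telescope (C := (∫ y, |K.ψ y|) * t ^ 2) (fun k => ?_) hl
  · rw [abs_sub_comm, pow_zero, div_one] at this
    linarith
  have h2 : (1 : ℝ) ≤ 2 ^ k := one_le_pow₀ one_le_two
  have htk : t / 2 ^ k ≤ t := div_le_self ht.le h2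
  have := S.two_scale (t := t / 2 ^ k) (x := x) K.testη K.testη K.testψ zero_le_one K.lap_eq
    (by positivity) (by linarith)
  rw [pow_succ, ← div_div, this, abs_mul, abs_of_nonneg (sq_nonneg _), div_pow]
  have hb := abs_pair_le_integral S.bdd_chi K.testψ (x := x) (t := t / 2 ^ k) (b := 1)
    fun y _ => S.bdd_chi.2 _
  have h3 : t ^ 2 / (2 ^ k) ^ 2 ≤ t ^ 2 / 2 ^ k := by
    gcongr
    nlinarith
  calc _ ≤ t ^ 2 / 2 ^ k * (1 * ∫ y, |K.ψ y|) := by gcongr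
    _ = _ := by ring

lemma abs_pair_dd_le (S : Sol M z Ω u) {t : ℝ} (ht : 0 < t) {x : 𝔼 N} (hx : dist x z + t < 1)
    (hxΩ : x ∉ Ω) (v : 𝔼 N) :
    |pair u t x (dd v K.η)| ≤ 2 * (∫ y, |dd v K.ψ y|) * t ^ 2 := by
  have hxb : x ∈ ball z 1 := by rw [mem_ball]; linarith
  obtain ⟨h0, h1⟩ := S.crit x hxb hxΩ
  have hl := tendsto_pair_of_fderiv S.bdd (K.testη.dir v) h0
    (h1 ▸ (S.diff x hxb).hasFDerivAt) t ht
  have := abs_sub_le_of_telescope (C := (∫ y, |dd v K.ψ y|) * t ^ 2) (fun k => ?_) hl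
  · rw [sub_zero, pow_zero, div_one, one_mul] at this
    linarith
  have h2 : (1 : ℝ) ≤ 2 ^ k := one_le_pow₀ one_le_two
  have htk : t / 2 ^ k ≤ t := div_le_self ht.le h2
  have := S.two_scale (t := t / 2 ^ k) (x := x) (K.testη.dir v) ((K.testη.dir v).const_mul 2)
    (K.testψ.dir v) zero_le_one (K.lap_dd_eq v) (by positivity) (by linarith)
  rw [pair_const_mul] at this
  have e : 2 ^ k * pair u (t / 2 ^ k) x (dd v K.η) -
      2 ^ (k + 1) * pair u (t / 2 ^ (k + 1)) x (dd v K.η) =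
      2 ^ k * ((t / 2 ^ k) ^ 2 * pair (chi Ω) (t / 2 ^ k) x (dd v K.ψ)) := by
    rw [← this, pow_succ, ← div_div]
    ring
  have hb := abs_pair_le_integral S.bdd_chi (K.testψ.dir v) (x := x) (t := t / 2 ^ k) (b := 1)
    fun y _ => S.bdd_chi.2 _
  rw [e, abs_mul, abs_mul, abs_of_pos (by positivity : (0 : ℝ) < 2 ^ k),
    abs_of_nonneg (sq_nonneg (t / 2 ^ k))]
  calc _ ≤ 2 ^ k * ((t / 2 ^ k) ^ 2 * (1 * ∫ y, |dd v K.ψ y|)) := by gcongr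
    _ = _ := by field_simp

end Sol

variable (K : KernelPair N)

lemma KernelPair.exists_taylorRem_pair_le : ∃ C, 0 ≤ C ∧
    ∀ (M : ℝ) (z : 𝔼 N) (Ω : Set (𝔼 N)) (u : (𝔼 N) → ℝ), Sol M z Ω u → ∀ x v : 𝔼 N,
      dist x z ≤ 1 / 4 → ∀ k, ‖v‖ ≤ scale k →
        |pair u (scale k) x (taylorRem ((scale k)⁻¹ • v) K.η)| ≤ C * (1 + M) * scale k ^ 2 := by
  obtain ⟨C₁, hC₁, h₁⟩ := K.testη.exists_taylorRem_le
  obtain ⟨C₂, hC₂, h₂⟩ := K.testψ.exists_taylorRem_le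
  have hV := ballVol_nonneg N (1 + 1)
  set V := ballVol N (1 + 1) with hVdef
  refine ⟨64 * (C₁ * V) + 2 * (C₂ * V), by positivity, fun M z Ω u S x v hx => ?_⟩
  have hn : ∀ k, ‖(scale k)⁻¹ • v‖ = ‖v‖ / scale k := fun k => by
    rw [norm_smul, norm_inv, Real.norm_of_nonneg (scale_pos k).le, inv_mul_eq_div]
  have hn1 : ∀ k, ‖v‖ ≤ scale k → ‖(scale k)⁻¹ • v‖ ≤ 1 := fun k hk => by
    rw [hn]
    exact div_le_one_of_le₀ hk (scale_pos k).le
  have hM := S.nonneg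
  have key : ∀ k, ‖v‖ ≤ scale k →
      |pair u (scale k) x (taylorRem ((scale k)⁻¹ • v) K.η)| ≤
        64 * (C₁ * V) * M * ‖v‖ ^ 3 + 2 * (C₂ * V) * (‖v‖ ^ 3 / scale k) := by
    intro k
    induction k with
    | zero =>
      intro hk
      have := abs_pair_le (t := scale 0) (x := x) S.bdd (K.testη.taylorRem (hn1 0 hk)) hM
        (fun y _ => S.bdd.2 _) (h₁ _)
      rw [hn, ← hVdef] at this
      refine this.trans ?_
      have h0 : 0 ≤ 2 * (C₂ * V) * (‖v‖ ^ 3 / scale 0) := by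
        have := scale_pos 0
        positivity
      rw [scale_zero] at this h0 ⊢
      calc _ = 64 * (C₁ * V) * M * ‖v‖ ^ 3 := by ring
        _ ≤ _ := by linarith
    | succ k ih =>
      intro hk
      have hs := scale_pos k
      have hk' : ‖v‖ ≤ scale k := by rw [scale_succ] at hk; linarith
      have hσ : (2 : ℝ) • (scale k)⁻¹ • v = (scale (k + 1))⁻¹ • v := by
        rw [smul_smul, scale_succ]
        congr 1
        field_simp
      have h2 := K.lap_taylorRem_eq ((scale k)⁻¹ • v)
      rw [hσ] at h2
      have := S.two_scale (t := scale k) (x := x) (K.testη.taylorRem (hn1 k hk'))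
        (K.testη.taylorRem (hn1 (k + 1) hk)) (K.testψ.taylorRem (hn1 k hk')) (by norm_num) h2 hs
        (by linarith [scale_le k])
      rw [← scale_succ] at this
      have hb := abs_pair_le (t := scale k) (x := x) S.bdd_chi (K.testψ.taylorRem (hn1 k hk'))
        zero_le_one (fun y _ => S.bdd_chi.2 _) (h₂ _)
      rw [hn, one_mul, ← hVdef] at hb
      have hd : |scale k ^ 2 * pair (chi Ω) (scale k) x (taylorRem ((scale k)⁻¹ • v) K.ψ)| ≤
          C₂ * V * (‖v‖ ^ 3 / scale k) := by
        rw [abs_mul, abs_of_nonneg (sq_nonneg _)]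
        calc _ ≤ scale k ^ 2 * (C₂ * (‖v‖ / scale k) ^ 3 * V) := by gcongr
          _ = _ := by field_simp
      have e2 : ‖v‖ ^ 3 / scale (k + 1) = 2 * (‖v‖ ^ 3 / scale k) := by
        rw [scale_succ]
        field_simp
      have h0 : 0 ≤ C₂ * V * (‖v‖ ^ 3 / scale k) := by positivity
      rw [e2]
      have ih' := abs_le.1 (ih hk')
      have hd' := abs_le.1 hd
      rw [abs_le]
      constructor <;> linarith [ih'.1, ih'.2, hd'.1, hd'.2]
  intro k hk
  have hs := scale_pos k
  refine (key k hk).trans ?_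
  have h3 : ‖v‖ ^ 3 / scale k ≤ scale k ^ 2 := by
    rw [div_le_iff₀ hs, ← pow_succ]
    gcongr
  have h4 : ‖v‖ ^ 3 ≤ scale k ^ 2 := by
    calc ‖v‖ ^ 3 ≤ scale k ^ 3 := by gcongr
      _ = scale k ^ 2 * scale k := by ring
      _ ≤ scale k ^ 2 * 1 := by gcongr; linarith [scale_le k]
      _ = _ := by ring
  calc _ ≤ 64 * (C₁ * V) * M * scale k ^ 2 + 2 * (C₂ * V) * scale k ^ 2 := by gcongr
    _ ≤ _ := by
      have e1 : 0 ≤ C₁ * V * scale k ^ 2 := by positivity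
      have e2 : 0 ≤ C₂ * V * scale k ^ 2 * M := by positivity
      nlinarith

/-- Control of `u` near a contact point by its quadratic part at the same scale. -/
lemma KernelPair.exists_growth_le : ∃ C, 0 ≤ C ∧
    ∀ (M : ℝ) (z : 𝔼 N) (Ω : Set (𝔼 N)) (u : (𝔼 N) → ℝ), Sol M z Ω u → ∀ x v : 𝔼 N,
      dist x z ≤ 1 / 4 → x ∉ Ω → ∀ k, ‖v‖ ≤ scale k →
        |u (x + v)| ≤ C * (1 + M) * scale k ^ 2 +
          1 / 2 * ((scale k)⁻¹ ^ 2 * |pair u (scale k) x (dd v (dd v K.η))|) := by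
  obtain ⟨C₁, hC₁, h₁⟩ := K.exists_taylorRem_pair_le
  obtain ⟨C₂, hC₂, h₂⟩ := K.testψ.exists_dd_le
  have hV := ballVol_nonneg N 1
  have hI : 0 ≤ ∫ y, |K.ψ y| := integral_nonneg fun y => abs_nonneg _
  refine ⟨C₁ + 4 * (∫ y, |K.ψ y|) + 2 * (C₂ * ballVol N 1), by positivity,
    fun M z Ω u S x v hx hxΩ k hk => ?_⟩
  have hM := S.nonneg
  have hs := scale_pos k
  have hs4 := scale_le k
  have a1 := h₁ M z Ω u S x v hx k hk
  have a2 := S.abs_sub_avg_le K hs (x := x + v) (by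
    have := dist_triangle (x + v) x z
    rw [dist_self_add_left] at this
    linarith)
  have a3 := S.abs_sub_avg_le K hs (x := x) (by linarith)
  rw [(S.crit x (by rw [mem_ball]; linarith) hxΩ).1, zero_sub, abs_neg] at a3
  have a4 := S.abs_pair_dd_le K hs (x := x) (by linarith) hxΩ v
  have a5 := (K.testψ.dir v).integral_abs_le (h₂ v)
  have a6 : |(scale k)⁻¹ * pair u (scale k) x (dd v K.η)| ≤
      2 * (C₂ * ballVol N 1) * scale k ^ 2 := by
    rw [abs_mul, abs_of_pos (by positivity)]
    calc _ ≤ (scale k)⁻¹ * (2 * (C₂ * ‖v‖ * ballVol N 1) * scale k ^ 2) := by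
          gcongr
          exact a4.trans (by gcongr)
      _ = 2 * (C₂ * ballVol N 1) * (‖v‖ * scale k) := by field_simp
      _ ≤ 2 * (C₂ * ballVol N 1) * (scale k * scale k) := by gcongr
      _ = _ := by ring
  have e := pair_taylorRem (t := scale k) (x := x) S.bdd K.testη ((scale k)⁻¹ • v)
  rw [← pair_shift u hs.ne', dd_dd_smul_vec K.testη.1, dd_smul_vec, pair_const_mul,
    pair_const_mul] at e
  have e' : u (x + v) = (u (x + v) - pair u (scale k) (x + v) K.η) +
      pair u (scale k) x (taylorRem ((scale k)⁻¹ • v) K.η) + pair u (scale k) x K.η -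
      (scale k)⁻¹ * pair u (scale k) x (dd v K.η) +
      1 / 2 * ((scale k)⁻¹ ^ 2 * pair u (scale k) x (dd v (dd v K.η))) := by
    rw [e]
    ring
  have a7 : |1 / 2 * ((scale k)⁻¹ ^ 2 * pair u (scale k) x (dd v (dd v K.η)))| =
      1 / 2 * ((scale k)⁻¹ ^ 2 * |pair u (scale k) x (dd v (dd v K.η))|) := by
    rw [abs_mul, abs_mul, abs_of_pos (by positivity : (0 : ℝ) < (scale k)⁻¹ ^ 2)]
    norm_num
  have tri : ∀ a b c d e : ℝ, |a + b + c - d + e| ≤ |a| + |b| + |c| + |d| + |e| := by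
    intro a b c d e
    have := abs_add_le (a + b + c - d) e
    have := abs_sub (a + b + c) d
    have := abs_add_le (a + b) c
    have := abs_add_le a b
    linarith
  calc |u (x + v)| ≤ _ := (congrArg abs e').le.trans (tri _ _ _ _ _)
    _ ≤ 2 * (∫ y, |K.ψ y|) * scale k ^ 2 + C₁ * (1 + M) * scale k ^ 2 +
        2 * (∫ y, |K.ψ y|) * scale k ^ 2 + 2 * (C₂ * ballVol N 1) * scale k ^ 2 + _ := by
        rw [a7]
        gcongr
    _ ≤ _ := by
        have p1 : 0 ≤ (∫ y, |K.ψ y|) * scale k ^ 2 * M := by positivity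
        have p2 : 0 ≤ (C₂ * ballVol N 1) * scale k ^ 2 * M := by positivity
        nlinarith

end

section

/-! ### Density and the approximate Hessian -/

/-- The volume fraction, up to a dimensional constant, of `A` in the ball of radius `t` at `x`. -/
def dens (A : Set (𝔼 N)) (t : ℝ) (x : 𝔼 N) : ℝ := (t ^ N)⁻¹ * volume.real (A ∩ closedBall x t)

lemma dens_nonneg (A : Set (𝔼 N)) {t : ℝ} (ht : 0 < t) (x : 𝔼 N) : 0 ≤ dens A t x :=
  mul_nonneg (by positivity) measureReal_nonneg

lemma volume_closedBall_eq {t : ℝ} (ht : 0 < t) (x : 𝔼 N) :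
    volume.real (closedBall x t) = t ^ N * ballVol N 1 := by
  rw [Measure.addHaar_real_closedBall' _ _ ht.le, finrank_euclideanSpace, Fintype.card_fin, ballVol]

lemma dens_le (A : Set (𝔼 N)) {t : ℝ} (ht : 0 < t) (x : 𝔼 N) : dens A t x ≤ ballVol N 1 := by
  have : volume.real (A ∩ closedBall x t) ≤ volume.real (closedBall x t) :=
    measureReal_mono inter_subset_right measure_closedBall_lt_top.ne
  rw [volume_closedBall_eq ht] at this
  unfold dens
  rwa [inv_mul_le_iff₀ (by positivity)]

lemma pair_chi_closedBall {A : Set (𝔼 N)} (hA : MeasurableSet A) {t : ℝ} (ht : 0 < t) (x : 𝔼 N) :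
    pair (chi A) t x (chi (closedBall 0 1)) = dens A t x := by
  rw [pair_eq _ ht, dens, ← integral_indicator_one (hA.inter measurableSet_closedBall)]
  congr 2
  ext w
  have : t⁻¹ • (w - x) ∈ closedBall (0 : 𝔼 N) 1 ↔ w ∈ closedBall x t := by
    rw [mem_closedBall, mem_closedBall, dist_zero_right, norm_smul, norm_inv,
      Real.norm_of_nonneg ht.le, ← dist_eq_norm, inv_mul_le_iff₀ ht, mul_one]
  by_cases h1 : w ∈ A <;> by_cases h2 : w ∈ closedBall x t <;>
    simp only [chi, indicator, this, h1, h2, mem_inter_iff, if_true, if_false, and_true, and_false,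
      Pi.one_apply, mul_one, mul_zero]

lemma abs_pair_le_dens {f Φ : (𝔼 N) → ℝ} {B b C t : ℝ} {x : 𝔼 N} {A : Set (𝔼 N)}
    (hf : BddMeas B f) (hΦ : IsTest 1 Φ) (hA : MeasurableSet A) (ht : 0 < t)
    (hb : ∀ y, ‖y‖ ≤ 1 → |f (x + t • y)| ≤ b * chi A (x + t • y)) (hC : ∀ y, |Φ y| ≤ C) :
    |pair f t x Φ| ≤ b * C * dens A t x := by
  have hint : Integrable (chi (closedBall (0 : 𝔼 N) 1)) :=
    (integrable_indicator_iff measurableSet_closedBall).2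
      (integrableOn_const measure_closedBall_lt_top.ne)
  rw [← pair_chi_closedBall hA ht, pair, pair, ← integral_const_mul]
  refine abs_integral_le_integral_abs.trans (integral_mono (hf.integrable hΦ.integrable t x).abs
    (((bddMeas_chi hA).integrable hint t x).const_mul _) fun y => ?_)
  simp only [abs_mul]
  by_cases hy : ‖y‖ ≤ 1
  · have : chi (closedBall (0 : 𝔼 N) 1) y = 1 := indicator_of_mem (by simpa using hy) _
    rw [this, mul_one]
    calc _ ≤ b * chi A (x + t • y) * C :=
          mul_le_mul (hb y hy) (hC y) (abs_nonneg _) ((abs_nonneg _).trans (hb y hy))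
      _ = _ := by ring
  · have : chi (closedBall (0 : 𝔼 N) 1) y = 0 := indicator_of_notMem (by simpa using hy) _
    rw [hΦ.eq_zero (not_le.1 hy), this]
    simp

lemma tendsto_scale : Tendsto scale atTop (𝓝 0) := tendsto_scaled _

lemma ae_tendsto_dens {A : Set (𝔼 N)} (hA : MeasurableSet A) :
    ∀ᵐ x, x ∉ A → Tendsto (fun k => dens A (scale k) x) atTop (𝓝 0) := by
  filter_upwards [Besicovitch.ae_tendsto_measure_inter_div_of_measurableSet volume hA] with x hx hxA
  rw [indicator_of_notMem hxA] at hx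
  have h1 : Tendsto scale atTop (𝓝[>] 0) :=
    tendsto_nhdsWithin_iff.2 ⟨tendsto_scale, Eventually.of_forall scale_pos⟩
  have h2 := ((ENNReal.tendsto_toReal ENNReal.zero_ne_top).comp (hx.comp h1)).const_mul
    (ballVol N 1)
  rw [ENNReal.toReal_zero, mul_zero] at h2
  refine h2.congr fun k => ?_
  have hs := scale_pos k
  simp only [Function.comp_apply, ENNReal.toReal_div]
  change ballVol N 1 * (volume.real _ / volume.real _) = _
  have hV : 0 < ballVol N 1 :=
    ENNReal.toReal_pos (measure_closedBall_pos _ _ one_pos).ne' measure_closedBall_lt_top.ne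
  rw [volume_closedBall_eq hs, dens]
  field_simp

variable (K : KernelPair N)

/-- The second derivative in direction `v`, averaged at the scale `scale k`. -/
def hess (u : (𝔼 N) → ℝ) (v : 𝔼 N) (k : ℕ) (x : 𝔼 N) : ℝ :=
  (scale k)⁻¹ ^ 2 * pair u (scale k) x (dd v (dd v K.η))

namespace Sol

variable {M : ℝ} {z : 𝔼 N} {Ω : Set (𝔼 N)} {u : (𝔼 N) → ℝ}

lemma hess_sub (S : Sol M z Ω u) (v : 𝔼 N) (k : ℕ) {x : 𝔼 N} (hx : dist x z ≤ 1 / 4) :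
    hess K u v k x - hess K u v (k + 1) x = pair (chi Ω) (scale k) x (dd v (dd v K.ψ)) := by
  have hs := scale_pos k
  have := S.two_scale (t := scale k) (x := x) ((K.testη.dir v).dir v)
    (((K.testη.dir v).dir v).const_mul 4) ((K.testψ.dir v).dir v) zero_le_one (K.lap_dd_dd_eq v)
    hs (by linarith [scale_le k])
  rw [pair_const_mul] at this
  unfold hess
  rw [scale_succ]
  have e : pair (chi Ω) (scale k) x (dd v (dd v K.ψ)) =
      (scale k)⁻¹ ^ 2 * (scale k ^ 2 * pair (chi Ω) (scale k) x (dd v (dd v K.ψ))) := by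
    field_simp
  rw [e, ← this]
  field_simp
  ring

lemma abs_hess_zero_le (S : Sol M z Ω u) {C : ℝ} (v : 𝔼 N) (hv : ‖v‖ ≤ 1) (hC0 : 0 ≤ C)
    (hC : ∀ v x, |dd v (dd v K.η) x| ≤ C * ‖v‖ ^ 2) (x : 𝔼 N) :
    |hess K u v 0 x| ≤ 16 * (C * ballVol N 1) * M := by
  have hV := ballVol_nonneg N 1
  have hM := S.nonneg
  have := abs_pair_le (t := scale 0) (x := x) S.bdd ((K.testη.dir v).dir v) hM
    (fun y _ => S.bdd.2 _) (hC v)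
  have h1 : ‖v‖ ^ 2 ≤ 1 := pow_le_one₀ (norm_nonneg _) hv
  unfold hess
  rw [abs_mul, abs_of_nonneg (sq_nonneg _), scale_zero] at *
  calc _ ≤ (1 / 4)⁻¹ ^ 2 * (M * (C * ‖v‖ ^ 2 * ballVol N 1)) := by gcongr
    _ ≤ (1 / 4)⁻¹ ^ 2 * (M * (C * 1 * ballVol N 1)) := by gcongr
    _ = _ := by ring

end Sol

lemma KernelPair.exists_hess_lip : ∃ C, 0 ≤ C ∧
    ∀ (M : ℝ) (z : 𝔼 N) (Ω : Set (𝔼 N)) (u : (𝔼 N) → ℝ), Sol M z Ω u → ∀ v w : 𝔼 N,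
      ‖v‖ ≤ 1 → ∀ k, ‖w‖ ≤ scale k → |hess K u v k (z + w) - hess K u v k z| ≤ C * (1 + M) := by
  obtain ⟨C₁, hC₁, h₁⟩ := K.testη.exists_dd_dd_sub_le
  obtain ⟨C₂, hC₂, h₂⟩ := K.testψ.exists_dd_dd_sub_le
  have hV := ballVol_nonneg N (1 + 1)
  set V := ballVol N (1 + 1) with hVdef
  refine ⟨16 * (C₁ * V) + 2 * (C₂ * V), by positivity, fun M z Ω u S v w hv => ?_⟩
  have hM := S.nonneg
  have hv2 : ‖v‖ ^ 2 ≤ 1 := pow_le_one₀ (norm_nonneg _) hv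
  have g₁ : ∀ σ y, |dd v (dd v K.η) (y - σ) - dd v (dd v K.η) y| ≤ C₁ * ‖σ‖ := fun σ y =>
    (h₁ v σ y).trans (by gcongr; exact mul_le_of_le_one_right hC₁ hv2)
  have g₂ : ∀ σ y, |dd v (dd v K.ψ) (y - σ) - dd v (dd v K.ψ) y| ≤ C₂ * ‖σ‖ := fun σ y =>
    (h₂ v σ y).trans (by gcongr; exact mul_le_of_le_one_right hC₂ hv2)
  have key : ∀ k, ‖w‖ ≤ scale k → |hess K u v k (z + w) - hess K u v k z| ≤
      16 * (C₁ * V) * M + 2 * (C₂ * V) * (‖w‖ / scale k) := by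
    intro k
    induction k with
    | zero =>
      intro hk
      have := abs_pair_add_sub_le (t := scale 0) (x := z) S.bdd hM ((K.testη.dir v).dir v) g₁
        (scale_pos 0) hk
      have h1 : ‖w‖ / scale 0 ≤ 1 := div_le_one_of_le₀ hk (scale_pos 0).le
      have h0 : 0 ≤ ‖w‖ / scale 0 := div_nonneg (norm_nonneg _) (scale_pos 0).le
      unfold hess
      rw [← mul_sub, abs_mul, abs_of_nonneg (sq_nonneg _)]
      calc _ ≤ (scale 0)⁻¹ ^ 2 * (M * (C₁ * V) * 1) := by
            gcongr
            exact this.trans (by gcongr)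
        _ = 16 * (C₁ * V) * M := by rw [scale_zero]; ring
        _ ≤ _ := le_add_of_nonneg_right (by positivity)
    | succ k ih =>
      intro hk
      have hs := scale_pos k
      have hk' : ‖w‖ ≤ scale k := by rw [scale_succ] at hk; linarith
      have e1 := S.hess_sub K v k (x := z + w)
        (by rw [dist_self_add_left]; linarith [scale_le k])
      have e2 := S.hess_sub K v k (x := z) (by rw [dist_self]; norm_num)
      have := abs_pair_add_sub_le (t := scale k) (x := z) S.bdd_chi zero_le_one
        ((K.testψ.dir v).dir v) g₂ hs hk'
      rw [one_mul, ← hVdef, ← e1, ← e2] at this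
      have e3 : ‖w‖ / scale (k + 1) = 2 * (‖w‖ / scale k) := by
        rw [scale_succ]
        field_simp
      have h0 : 0 ≤ C₂ * V * (‖w‖ / scale k) := by positivity
      rw [e3]
      have i1 := abs_le.1 (ih hk')
      have i2 := abs_le.1 this
      rw [abs_le]
      constructor <;> linarith [i1.1, i1.2, i2.1, i2.2]
  intro k hk
  refine (key k hk).trans ?_
  have h1 : ‖w‖ / scale k ≤ 1 := div_le_one_of_le₀ hk (scale_pos k).le
  calc _ ≤ 16 * (C₁ * V) * M + 2 * (C₂ * V) * 1 := by gcongr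
    _ ≤ _ := by
      have e1 : 0 ≤ C₁ * V := by positivity
      have e2 : 0 ≤ C₂ * V * M := by positivity
      nlinarith

/-- At density points of the contact set the approximate Hessian vanishes. -/
lemma Sol.ae_tendsto_hess {M : ℝ} {z : 𝔼 N} {Ω : Set (𝔼 N)} {u : (𝔼 N) → ℝ} (S : Sol M z Ω u)
    {v : 𝔼 N} (hv : ‖v‖ ≤ 1) :
    ∀ᵐ x, x ∉ Ω → dist x z ≤ 1 / 4 → Tendsto (fun k => hess K u v k x) atTop (𝓝 0) := by
  obtain ⟨C₁, hC₁, h₁⟩ := K.exists_growth_le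
  obtain ⟨C₂, hC₂, h₂⟩ := K.testη.exists_dd_dd_le
  have hM := S.nonneg
  filter_upwards [ae_tendsto_dens S.isOpen.measurableSet] with x hdens hxΩ hxz
  have hd := hdens hxΩ
  have hgrow : ∀ᶠ k in atTop, ∀ w, ‖w‖ ≤ scale k →
      |u (x + w)| ≤ 2 * (C₁ * (1 + M)) * scale k ^ 2 := by
    have hev : ∀ᶠ k in atTop, C₂ * dens Ω (scale k) x < 1 := by
      have := hd.const_mul C₂
      rw [mul_zero] at this
      exact this.eventually (gt_mem_nhds one_pos)
    filter_upwards [hev] with k hk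
    have hs := scale_pos k
    have hcont : ContinuousOn (fun w => |u (x + w)|) (closedBall 0 (scale k)) := by
      intro w hw
      rw [mem_closedBall, dist_zero_right] at hw
      have hm : x + w ∈ ball z 1 := by
        rw [mem_ball]
        have := dist_triangle (x + w) x z
        rw [dist_self_add_left] at this
        linarith [scale_le k]
      exact ((S.diff _ hm).continuousAt.comp (f := fun w => x + w)
        (by fun_prop)).abs.continuousWithinAt
    obtain ⟨w₀, hw₀, hmax⟩ := (isCompact_closedBall (0 : 𝔼 N) (scale k)).exists_isMaxOn
      ⟨0, by simpa using hs.le⟩ hcont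
    set b := |u (x + w₀)| with hb
    have hmax' : ∀ w, ‖w‖ ≤ scale k → |u (x + w)| ≤ b := fun w hw =>
      hmax (by rwa [mem_closedBall, dist_zero_right])
    rw [mem_closedBall, dist_zero_right] at hw₀
    have g := h₁ M z Ω u S x w₀ hxz hxΩ k hw₀
    have p := abs_pair_le_dens (b := b) (x := x) S.bdd ((K.testη.dir w₀).dir w₀)
      S.isOpen.measurableSet hs (fun y hy => ?_) (h₂ w₀)
    · have hn2 : (scale k)⁻¹ ^ 2 * ‖w₀‖ ^ 2 ≤ 1 := by
        rw [← mul_pow, inv_mul_eq_div]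
        exact pow_le_one₀ (by positivity) (div_le_one_of_le₀ hw₀ hs.le)
      have hq : (scale k)⁻¹ ^ 2 * |pair u (scale k) x (dd w₀ (dd w₀ K.η))| ≤ b := by
        have hdn := dens_nonneg Ω hs x
        calc _ ≤ (scale k)⁻¹ ^ 2 * (b * (C₂ * ‖w₀‖ ^ 2) * dens Ω (scale k) x) := by gcongr
          _ = ((scale k)⁻¹ ^ 2 * ‖w₀‖ ^ 2) * (b * (C₂ * dens Ω (scale k) x)) := by ring
          _ ≤ 1 * (b * 1) := by gcongr
          _ = b := by ring
      intro w hw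
      linarith [hmax' w hw]
    · have hny : ‖scale k • y‖ ≤ scale k := by
        rw [norm_smul, Real.norm_of_nonneg hs.le]
        exact mul_le_of_le_one_right hs.le hy
      by_cases hm : x + scale k • y ∈ Ω
      · rw [chi, indicator_of_mem hm, mul_one]
        exact hmax' _ hny
      · rw [(S.crit _ ?_ hm).1, chi, indicator_of_notMem hm]
        · simp
        · rw [mem_ball]
          have := dist_triangle (x + scale k • y) x z
          rw [dist_self_add_left] at this
          linarith [scale_le k]
  have hlim := hd.const_mul (2 * (C₁ * (1 + M)) * C₂)
  rw [mul_zero] at hlim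
  refine squeeze_zero_norm' ?_ hlim
  filter_upwards [hgrow] with k hk
  have hs := scale_pos k
  have p := abs_pair_le_dens (b := 2 * (C₁ * (1 + M)) * scale k ^ 2) (x := x) S.bdd
    ((K.testη.dir v).dir v) S.isOpen.measurableSet hs (fun y hy => ?_) (h₂ v)
  · have hdn := dens_nonneg Ω hs x
    have hv2 : ‖v‖ ^ 2 ≤ 1 := pow_le_one₀ (norm_nonneg _) hv
    rw [hess, Real.norm_eq_abs, abs_mul, abs_of_nonneg (sq_nonneg _)]
    calc _ ≤ (scale k)⁻¹ ^ 2 * (2 * (C₁ * (1 + M)) * scale k ^ 2 * (C₂ * ‖v‖ ^ 2) *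
          dens Ω (scale k) x) := by gcongr
      _ ≤ (scale k)⁻¹ ^ 2 * (2 * (C₁ * (1 + M)) * scale k ^ 2 * (C₂ * 1) *
          dens Ω (scale k) x) := by gcongr
      _ = _ := by field_simp
  · have hny : ‖scale k • y‖ ≤ scale k := by
      rw [norm_smul, Real.norm_of_nonneg hs.le]
      exact mul_le_of_le_one_right hs.le hy
    by_cases hm : x + scale k • y ∈ Ω
    · rw [chi, indicator_of_mem hm, mul_one]
      exact hk _ hny
    · rw [(S.crit _ ?_ hm).1, chi, indicator_of_notMem hm]
      · simp
      · rw [mem_ball]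
        have := dist_triangle (x + scale k • y) x z
        rw [dist_self_add_left] at this
        linarith [scale_le k]

end

section

/-! ### The `L²` estimate for the approximate Hessian -/

section average

variable {f φ g : (𝔼 N) → ℝ} {R t : ℝ}

open scoped Convolution

lemma dd_convolution (hf : LocallyIntegrable f) (hg : IsTest R g) (v : 𝔼 N) :
    dd v (f ⋆[ContinuousLinearMap.mul ℝ ℝ] g) = f ⋆[ContinuousLinearMap.mul ℝ ℝ] dd v g := by
  ext x
  have := hg.hasCompactSupport.hasFDerivAt_convolution_right (ContinuousLinearMap.mul ℝ ℝ) hf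
    (hg.1.of_le (by norm_cast)) x
  rw [dd, this.fderiv]
  exact convolution_precompR_apply _ hf (hg.hasCompactSupport.fderiv ℝ)
    (hg.1.continuous_fderiv (by simp)) x v

lemma IsTest.reflect (hφ : IsTest R φ) (ht : 0 < t) :
    IsTest (R * t) (fun y => φ ((-t⁻¹) • y)) := by
  refine IsTest.of_eq_zero (hφ.1.comp (by fun_prop)) fun x hx => hφ.eq_zero ?_
  rwa [norm_smul, norm_neg, norm_inv, Real.norm_of_nonneg ht.le, inv_mul_eq_div, lt_div_iff₀ ht]

lemma pair_eq_convolution (f φ : (𝔼 N) → ℝ) (ht : 0 < t) : (fun x => pair f t x φ) =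
    fun x => (t ^ N)⁻¹ * (f ⋆[ContinuousLinearMap.mul ℝ ℝ] fun y => φ ((-t⁻¹) • y)) x := by
  ext x
  rw [pair_eq _ ht, convolution_def]
  simp only [ContinuousLinearMap.mul_apply', neg_smul, ← smul_neg, neg_sub]

lemma contDiff_pair (hf : LocallyIntegrable f) (hφ : IsTest R φ) (ht : 0 < t) :
    ContDiff ℝ ∞ fun x => pair f t x φ := by
  rw [pair_eq_convolution f φ ht]
  have hg := hφ.reflect ht
  exact contDiff_const.mul (hg.hasCompactSupport.contDiff_convolution_right _ hf hg.1)

lemma dd_pair (hf : LocallyIntegrable f) (hφ : IsTest R φ) (ht : 0 < t) (v : 𝔼 N) :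
    dd v (fun x => pair f t x φ) = fun x => -t⁻¹ * pair f t x (dd v φ) := by
  have hg := hφ.reflect ht
  have h1 := dd_comp_affine hφ.1 0 (-t⁻¹) v
  simp only [zero_add] at h1
  have h2 : (fun y => -t⁻¹ * dd v φ (-t⁻¹ • y)) = (-t⁻¹) • fun y => dd v φ (-t⁻¹ • y) := rfl
  have h3 := congrFun (pair_eq_convolution f (dd v φ) ht)
  ext x
  rw [h3, pair_eq_convolution f φ ht,
    dd_const_mul (hg.hasCompactSupport.contDiff_convolution_right _ hf hg.1),
    dd_convolution hf hg, h1, h2, convolution_smul]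
  simp only [Pi.smul_apply, smul_eq_mul]
  ring

lemma dd_dd_pair (hf : LocallyIntegrable f) (hφ : IsTest R φ) (ht : 0 < t) (v : 𝔼 N) :
    dd v (dd v (fun x => pair f t x φ)) = fun x => t⁻¹ ^ 2 * pair f t x (dd v (dd v φ)) := by
  rw [dd_pair hf hφ ht, dd_const_mul (contDiff_pair hf (hφ.dir v) ht), dd_pair hf (hφ.dir v) ht]
  ext x
  ring

lemma lap_pair {B : ℝ} (hf : LocallyIntegrable f) (hB : BddMeas B f) (hφ : IsTest R φ) (ht : 0 < t)
    (x : 𝔼 N) : lap N (fun x => pair f t x φ) x = t⁻¹ ^ 2 * pair f t x (lap N φ) := by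
  rw [lap_eq_sum]
  simp only [dd_dd_pair hf hφ ht, ← Finset.mul_sum]
  congr 1
  unfold pair
  rw [← integral_finsetSum _ fun i _ => hB.integrable ((hφ.dir _).dir _).integrable t x]
  simp only [lap_eq_sum, Finset.mul_sum]

lemma IsTest.pair {ρ : ℝ} (hf : LocallyIntegrable f) (hf0 : ∀ x, ρ < ‖x‖ → f x = 0)
    (hφ : IsTest R φ) (ht : 0 < t) : IsTest (ρ + R * t) fun x => pair f t x φ := by
  refine IsTest.of_eq_zero (contDiff_pair hf hφ ht) fun x hx => ?_
  rw [_root_.pair, ← integral_zero (𝔼 N) ℝ]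
  congr 1
  ext y
  by_cases hy : ‖y‖ ≤ R
  · rw [hf0, zero_mul]
    have h1 := norm_sub_le (x + t • y) (t • y)
    rw [add_sub_cancel_right, norm_smul, Real.norm_of_nonneg ht.le] at h1
    nlinarith
  · rw [hφ.eq_zero (not_le.1 hy), mul_zero]

lemma integral_average (hf : Integrable f) (hφ : IsTest R φ) (ht : 0 < t) :
    ∫ x, pair f t x φ = (∫ x, f x) * ∫ x, φ x := by
  have hg := hφ.reflect ht
  have := Measure.integral_comp_smul (volume : Measure (𝔼 N)) φ (-t⁻¹)
  rw [finrank_euclideanSpace, Fintype.card_fin, smul_eq_mul] at this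
  rw [pair_eq_convolution f φ ht, integral_const_mul,
    integral_convolution _ hf hg.integrable, this]
  have e : |((-t⁻¹) ^ N)⁻¹| = t ^ N := by
    rw [abs_inv, abs_pow, abs_neg, abs_inv, abs_of_pos ht, inv_pow, inv_inv]
  rw [e, ContinuousLinearMap.mul_apply']
  field_simp

lemma IsTest.integrable_sq (hφ : IsTest R φ) : Integrable fun x => φ x ^ 2 := by
  simp only [sq]
  exact (hφ.continuous.mul hφ.continuous).integrable_of_hasCompactSupport
    hφ.hasCompactSupport.mul_left

end average

variable (K : KernelPair N)

lemma KernelPair.integral_sq_sum_le {A : Set (𝔼 N)} (hA : MeasurableSet A)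
    (hb : Bornology.IsBounded A) {v : 𝔼 N} (hv : ‖v‖ ≤ 1) (k n : ℕ) :
    Integrable (fun x => (∑ j ∈ Finset.range n,
      pair (chi A) (scale (k + j)) x (dd v (dd v K.ψ))) ^ 2) ∧
    ∫ x, (∑ j ∈ Finset.range n, pair (chi A) (scale (k + j)) x (dd v (dd v K.ψ))) ^ 2 ≤
      2 * volume.real A := by
  obtain ⟨ρ, hρ⟩ := hb.subset_closedBall (0 : 𝔼 N)
  have hfin : volume A ≠ ⊤ := hb.measure_lt_top.ne
  have hint : Integrable (chi A) := (integrable_indicator_iff hA).2 (integrableOn_const hfin)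
  have hI : ∫ x, chi A x = volume.real A := integral_indicator_one hA
  have hloc := hint.locallyIntegrable
  have hB := bddMeas_chi hA
  have h0 : ∀ x, ρ < ‖x‖ → chi A x = 0 := fun x hx => indicator_of_notMem (fun hxA => by
    have := hρ hxA
    rw [mem_closedBall, dist_zero_right] at this
    linarith) _
  have hs := scale_pos
  have hp : ∀ j, IsTest (ρ + 1) fun x => pair (chi A) (scale j) x K.ψ := fun j =>
    (IsTest.pair hloc h0 K.testψ (hs j)).mono (by linarith [scale_le j])
  have he : ∀ j, IsTest (ρ + 1) fun x => pair (chi A) (scale j) x K.η := fun j =>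
    (IsTest.pair hloc h0 K.testη (hs j)).mono (by linarith [scale_le j])
  set V : (𝔼 N) → ℝ := fun x => ∑ j ∈ Finset.range n,
    scale (k + j) ^ 2 * pair (chi A) (scale (k + j)) x K.ψ with hVdef
  have hVt : IsTest (ρ + 1) V := IsTest.of_eq_zero
    (ContDiff.sum fun j _ => ((hp _).const_mul _).1)
    fun x hx => Finset.sum_eq_zero fun j _ => ((hp _).const_mul _).eq_zero hx
  have hdd : dd v (dd v V) = fun x => ∑ j ∈ Finset.range n,
      pair (chi A) (scale (k + j)) x (dd v (dd v K.ψ)) := by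
    rw [hVdef, dd_sum _ fun j _ => ((hp _).const_mul _).1,
      dd_sum _ fun j _ => (((hp _).const_mul _).dir v).1]
    ext x
    refine Finset.sum_congr rfl fun j _ => ?_
    rw [dd_const_mul (hp _).1, dd_const_mul ((hp _).dir v).1, dd_dd_pair hloc K.testψ (hs _)]
    have := hs (k + j)
    field_simp
  have hlap : ∀ x, lap N V x =
      pair (chi A) (scale k) x K.η - pair (chi A) (scale (k + n)) x K.η := by
    intro x
    have hsum := Finset.sum_range_sub' (fun j => pair (chi A) (scale (k + j)) x K.η) n
    rw [add_zero] at hsum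
    rw [hVdef, lap_sum _ fun j _ => ((hp _).const_mul _).1, ← hsum]
    refine Finset.sum_congr rfl fun j _ => ?_
    rw [lap_const_mul (hp _).1, lap_pair hloc hB K.testψ (hs _), K.lap_eq,
      pair_sub hB K.testη.integrable
        ((K.testη.comp_smul one_le_two zero_le_one).const_mul _).integrable, pair_half,
      ← add_assoc, scale_succ]
    have := hs (k + j)
    field_simp
  have hη0 : ∀ j x, 0 ≤ pair (chi A) (scale j) x K.η := fun j x =>
    integral_nonneg fun y => mul_nonneg (chi_nonneg _ _) (K.η_nonneg y)
  have hη1 : ∀ j x, pair (chi A) (scale j) x K.η ≤ 1 := fun j x => by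
    rw [← K.integralη]
    exact integral_mono (hB.integrable K.testη.integrable _ _) K.testη.integrable fun y =>
      mul_le_of_le_one_left (K.η_nonneg y) (chi_le_one _ _)
  have hηI : ∀ j, ∫ x, pair (chi A) (scale j) x K.η = volume.real A := fun j => by
    rw [integral_average hint K.testη (hs j), hI, K.integralη, mul_one]
  have hsq := ((hVt.dir v).dir v).integrable_sq
  have hlq := hVt.laplace.integrable_sq
  have hle := hVt.integral_sq_dd_dd_le hv
  rw [hdd] at hsq hle
  refine ⟨hsq, hle.trans ?_⟩
  calc ∫ x, lap N V x ^ 2 ≤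
        ∫ x, (pair (chi A) (scale k) x K.η + pair (chi A) (scale (k + n)) x K.η) := by
        refine integral_mono hlq ((he _).integrable.add (he _).integrable) fun x => ?_
        have a0 := hη0 k x
        have a1 := hη1 k x
        have b0 := hη0 (k + n) x
        have b1 := hη1 (k + n) x
        dsimp only
        rw [hlap]
        nlinarith [mul_nonneg a0 b0]
    _ = 2 * volume.real A := by
        rw [integral_add (he _).integrable (he _).integrable, hηI, hηI]
        ring

end

section

/-! ### Quadratic growth at a free boundary point -/

lemma scale_anti {j k : ℕ} (h : j ≤ k) : scale k ≤ scale j := by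
  unfold scale
  gcongr
  exact one_le_two

lemma pair_chi_eq_neg {Ω : Set (𝔼 N)} (hΩ : MeasurableSet Ω) {z x : 𝔼 N} {r t : ℝ} (ht : 0 < t)
    (hx : dist x z + t ≤ r) {Φ : (𝔼 N) → ℝ} (hΦ : IsTest 1 Φ) (h0 : ∫ y, Φ y = 0) :
    pair (chi Ω) t x Φ = - pair (chi (Ωᶜ ∩ closedBall z r)) t x Φ := by
  have h1 := (bddMeas_chi hΩ).integrable hΦ.integrable t x
  have h2 := (bddMeas_chi (hΩ.compl.inter (measurableSet_closedBall (x := z) (ε := r)))).integrable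
    hΦ.integrable t x
  rw [eq_neg_iff_add_eq_zero, pair, pair, ← integral_add h1 h2, ← h0]
  congr 1
  ext y
  by_cases hy : ‖y‖ ≤ 1
  · have hm : x + t • y ∈ closedBall z r := by
      rw [mem_closedBall]
      have h3 := dist_triangle (x + t • y) x z
      rw [dist_self_add_left, norm_smul, Real.norm_of_nonneg ht.le] at h3
      nlinarith
    by_cases hm' : x + t • y ∈ Ω <;> simp [chi, hm, hm']
  · simp [hΦ.eq_zero (not_le.1 hy)]

variable (K : KernelPair N)

namespace Sol

variable {M : ℝ} {z : 𝔼 N} {Ω : Set (𝔼 N)} {u : (𝔼 N) → ℝ}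

lemma measure_decay (S : Sol M z Ω u) {v : 𝔼 N} (hv : ‖v‖ ≤ 1) (k : ℕ) {c : ℝ} (hc : 0 ≤ c)
    (h : ∀ w, ‖w‖ ≤ scale (k + 1) → c ≤ |hess K u v (k + 1) (z + w)|) :
    c ^ 2 * volume.real (Ωᶜ ∩ closedBall z (scale (k + 1))) ≤
      2 * volume.real (Ωᶜ ∩ closedBall z (scale k)) := by
  have hΩ := S.isOpen.measurableSet
  have hS : MeasurableSet (Ωᶜ ∩ closedBall z (scale (k + 1))) :=
    hΩ.compl.inter measurableSet_closedBall
  have hψ := (K.testψ.dir v).dir v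
  obtain ⟨hGi, hGb⟩ := forall_and.1 (K.integral_sq_sum_le
    (hΩ.compl.inter (measurableSet_closedBall (x := z) (ε := scale k)))
    (isBounded_closedBall.subset inter_subset_right) hv (k + 1))
  set A := Ωᶜ ∩ closedBall z (scale k)
  set G : ℕ → (𝔼 N) → ℝ := fun n x => ∑ j ∈ Finset.range n,
    pair (chi A) (scale (k + 1 + j)) x (dd v (dd v K.ψ)) with hG
  have hGhess : ∀ n x, dist x z ≤ scale (k + 1) →
      G n x = hess K u v (k + 1 + n) x - hess K u v (k + 1) x := by
    intro n x hx
    have h4 := scale_le (k + 1)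
    have hsum := Finset.sum_range_sub (fun j => hess K u v (k + 1 + j) x) n
    rw [add_zero] at hsum
    rw [← hsum]
    refine Finset.sum_congr rfl fun j _ => ?_
    have h1 := S.hess_sub K v (k + 1 + j) (x := x) (by linarith)
    rw [pair_chi_eq_neg hΩ (z := z) (r := scale k) (scale_pos _) ?_ hψ
      ((K.testψ.dir v).integral_dd v)] at h1
    · rw [← add_assoc]
      linarith
    · have := scale_anti (Nat.le_add_right (k + 1) j)
      have h2 := scale_succ k
      linarith
  have hlim : ∀ᵐ x ∂(volume.restrict (Ωᶜ ∩ closedBall z (scale (k + 1)))),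
      ENNReal.ofReal (c ^ 2) ≤ liminf (fun n => ENNReal.ofReal (G n x ^ 2)) atTop := by
    rw [ae_restrict_iff' hS]
    filter_upwards [S.ae_tendsto_hess K hv] with x hx hxS
    have hxz : dist x z ≤ scale (k + 1) := hxS.2
    have h1 := (hx hxS.1 (hxz.trans (scale_le _))).comp
      (tendsto_add_atTop_nat (k + 1))
    have h2 : Tendsto (fun n => G n x) atTop (𝓝 (0 - hess K u v (k + 1) x)) := by
      refine (h1.sub_const _).congr fun n => ?_
      rw [hGhess n x hxz, Function.comp_apply, add_comm n]
    have h3 := (ENNReal.continuous_ofReal.tendsto _).comp (h2.pow 2)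
    have h4 := h3.liminf_eq
    simp only [Function.comp_def] at h4
    rw [h4]
    refine ENNReal.ofReal_le_ofReal ?_
    rw [zero_sub, neg_sq, ← sq_abs (hess K u v (k + 1) x)]
    have h5 := h (x - z) (by rwa [← dist_eq_norm])
    rw [add_sub_cancel] at h5
    gcongr
  have hGl : ∀ n, ∫⁻ x in Ωᶜ ∩ closedBall z (scale (k + 1)), ENNReal.ofReal (G n x ^ 2) ≤
      ENNReal.ofReal (2 * volume.real A) := fun n => by
    refine (setLIntegral_le_lintegral _ _).trans ?_
    rw [← ofReal_integral_eq_lintegral_ofReal (hGi n) (ae_of_all _ fun x => sq_nonneg _)]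
    exact ENNReal.ofReal_le_ofReal (hGb n)
  have hfin : volume (Ωᶜ ∩ closedBall z (scale (k + 1))) ≠ ⊤ :=
    ((measure_mono inter_subset_right).trans_lt measure_closedBall_lt_top).ne
  have key : ENNReal.ofReal (c ^ 2) * volume (Ωᶜ ∩ closedBall z (scale (k + 1))) ≤
      ENNReal.ofReal (2 * volume.real A) := by
    rw [← setLIntegral_const]
    calc _ ≤ ∫⁻ x in Ωᶜ ∩ closedBall z (scale (k + 1)),
          liminf (fun n => ENNReal.ofReal (G n x ^ 2)) atTop := lintegral_mono_ae hlim
      _ ≤ liminf (fun n => ∫⁻ x in Ωᶜ ∩ closedBall z (scale (k + 1)),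
          ENNReal.ofReal (G n x ^ 2)) atTop := lintegral_liminf_le'
            fun n => ((hGi n).aestronglyMeasurable.aemeasurable.ennreal_ofReal).restrict
      _ ≤ liminf (fun _ : ℕ => ENNReal.ofReal (2 * volume.real A)) atTop :=
          liminf_le_liminf (Eventually.of_forall hGl)
      _ = _ := liminf_const _
  have := ENNReal.toReal_mono ENNReal.ofReal_ne_top key
  rwa [ENNReal.toReal_mul, ENNReal.toReal_ofReal (sq_nonneg c),
    ENNReal.toReal_ofReal (mul_nonneg zero_le_two measureReal_nonneg)] at this

lemma dens_decay (S : Sol M z Ω u) {v : 𝔼 N} (hv : ‖v‖ ≤ 1) (k : ℕ)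
    (h : ∀ w, ‖w‖ ≤ scale (k + 1) → 2 * 2 ^ N ≤ |hess K u v (k + 1) (z + w)|) :
    2 * dens Ωᶜ (scale (k + 1)) z ≤ dens Ωᶜ (scale k) z := by
  have := S.measure_decay K hv k (by positivity) h
  have hs := scale_pos k
  have h1 : (1 : ℝ) ≤ 2 ^ N := one_le_pow₀ one_le_two
  have hm : 0 ≤ volume.real (Ωᶜ ∩ closedBall z (scale (k + 1))) := measureReal_nonneg
  unfold dens
  have e : (scale (k + 1) ^ N)⁻¹ = 2 ^ N * (scale k ^ N)⁻¹ := by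
    rw [scale_succ, div_pow, inv_div]
    rfl
  have h2 : 2 * (2 ^ N * volume.real (Ωᶜ ∩ closedBall z (scale (k + 1)))) ≤
      volume.real (Ωᶜ ∩ closedBall z (scale k)) := by
    nlinarith [mul_nonneg (mul_nonneg (sub_nonneg.2 h1) (by positivity : (0 : ℝ) ≤ 2 ^ N)) hm]
  rw [e]
  calc _ = (scale k ^ N)⁻¹ * (2 * (2 ^ N * volume.real (Ωᶜ ∩ closedBall z (scale (k + 1))))) := by
        ring
    _ ≤ _ := by gcongr

lemma abs_hess_sub_le (S : Sol M z Ω u) {C : ℝ} {v : 𝔼 N} (k : ℕ)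
    (hC : ∀ y, |dd v (dd v K.ψ) y| ≤ C) :
    |hess K u v (k + 1) z - hess K u v k z| ≤ C * dens Ωᶜ (scale k) z := by
  have hΩ := S.isOpen.measurableSet
  have h1 := S.hess_sub K v k (x := z) (by rw [dist_self]; norm_num)
  rw [abs_sub_comm, h1, pair_chi_eq_neg hΩ (z := z) (r := scale k) (scale_pos _)
    (by rw [dist_self, zero_add]) ((K.testψ.dir v).dir v) ((K.testψ.dir v).integral_dd v), abs_neg]
  rw [← one_mul C]
  refine abs_pair_le_dens (bddMeas_chi (hΩ.compl.inter measurableSet_closedBall))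
    ((K.testψ.dir v).dir v) hΩ.compl (scale_pos k) (fun y _ => ?_) hC
  rw [one_mul, abs_of_nonneg (chi_nonneg _ _)]
  exact indicator_le_indicator_of_subset inter_subset_left (fun _ => zero_le_one) _

end Sol

lemma KernelPair.exists_hess_le : ∃ C, 0 ≤ C ∧
    ∀ (M : ℝ) (z : 𝔼 N) (Ω : Set (𝔼 N)) (u : (𝔼 N) → ℝ), Sol M z Ω u → ∀ v : 𝔼 N,
      ‖v‖ ≤ 1 → ∀ k, |hess K u v k z| ≤ C * (1 + M) := by
  obtain ⟨CL, hCL, hL⟩ := K.exists_hess_lip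
  obtain ⟨C₁, hC₁, h₁⟩ := K.testη.exists_dd_dd_le
  obtain ⟨C₂, hC₂, h₂⟩ := K.testψ.exists_dd_dd_le
  have hV := ballVol_nonneg N 1
  set D := ballVol N 1 with hD
  refine ⟨CL + 2 * 2 ^ N + 2 * (C₂ * D) + 16 * (C₁ * D), by positivity, fun M z Ω u S v hv => ?_⟩
  have hM := S.nonneg
  have hv2 : ‖v‖ ^ 2 ≤ 1 := pow_le_one₀ (norm_nonneg _) hv
  have hstep := fun k => S.abs_hess_sub_le K k (v := v) (C := C₂)
    fun y => (h₂ v y).trans (mul_le_of_le_one_right hC₂ hv2)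
  have htri : ∀ k, |hess K u v (k + 1) z| ≤ |hess K u v k z| + C₂ * dens Ωᶜ (scale k) z :=
    fun k => by
      have := abs_sub_abs_le_abs_sub (hess K u v (k + 1) z) (hess K u v k z)
      linarith [hstep k]
  have hdD : ∀ k, C₂ * dens Ωᶜ (scale k) z ≤ C₂ * D := fun k =>
    mul_le_mul_of_nonneg_left (dens_le _ (scale_pos k) z) hC₂
  have hd0 : ∀ k, 0 ≤ C₂ * dens Ωᶜ (scale k) z := fun k =>
    mul_nonneg hC₂ (dens_nonneg _ (scale_pos k) z)
  have h0 := S.abs_hess_zero_le K v hv hC₁ h₁ z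
  have p1 : 0 ≤ C₂ * D := by positivity
  have p2 : 0 ≤ C₁ * D := by positivity
  have p3 : (0 : ℝ) ≤ 2 * 2 ^ N := by positivity
  have p4 : 0 ≤ C₂ * D * M := by positivity
  have p5 : 0 ≤ CL * M := by positivity
  have p6 : 0 ≤ (2 * 2 ^ N) * M := by positivity
  have p7 : 0 ≤ C₁ * D * M := by positivity
  have key : ∀ k, |hess K u v (k + 1) z| + C₂ * dens Ωᶜ (scale k) z ≤
      (CL + 2 * 2 ^ N + 2 * (C₂ * D) + 16 * (C₁ * D)) * (1 + M) := by
    intro k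
    induction k with
    | zero =>
      have := htri 0
      have := hdD 0
      rw [← hD] at h0
      nlinarith
    | succ k ih =>
      have h3 := htri (k + 1)
      by_cases hbig : (CL + 2 * 2 ^ N) * (1 + M) ≤ |hess K u v (k + 1) z|
      · have := S.dens_decay K hv k fun w hw => by
          have h4 := hL M z Ω u S v w hv (k + 1) hw
          rw [abs_sub_comm] at h4
          have h5 := abs_sub_abs_le_abs_sub (hess K u v (k + 1) z) (hess K u v (k + 1) (z + w))
          nlinarith
        have h6 := mul_le_mul_of_nonneg_left this hC₂
        linarith
      · rw [not_le] at hbig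
        have := hdD (k + 1)
        nlinarith
  intro k
  cases k with
  | zero =>
    rw [← hD] at h0
    nlinarith
  | succ k => linarith [key k, hd0 k]

lemma KernelPair.exists_quadratic_growth (K : KernelPair N) : ∃ C, 0 ≤ C ∧
    ∀ (M : ℝ) (z : 𝔼 N) (Ω : Set (𝔼 N)) (u : (𝔼 N) → ℝ), Sol M z Ω u → ∀ (v : 𝔼 N) (k : ℕ),
      ‖v‖ ≤ scale k → |u (z + v)| ≤ C * (1 + M) * scale k ^ 2 := by
  obtain ⟨C₁, hC₁, h₁⟩ := K.exists_growth_le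
  obtain ⟨C₂, hC₂, h₂⟩ := K.exists_hess_le
  refine ⟨C₁ + C₂, by positivity, fun M z Ω u S v k hk => ?_⟩
  have hM := S.nonneg
  have hs := scale_pos k
  have a1 := h₁ M z Ω u S z v (by rw [dist_self]; norm_num) S.notMem k hk
  have a2 := h₂ M z Ω u S ((scale k)⁻¹ • v) (by
    rw [norm_smul, norm_inv, Real.norm_of_nonneg hs.le, inv_mul_eq_div]
    exact div_le_one_of_le₀ hk hs.le) k
  rw [hess, dd_dd_smul_vec K.testη.1, pair_const_mul, abs_mul, abs_mul,
    abs_of_nonneg (sq_nonneg _)] at a2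
  have a3 : (scale k)⁻¹ ^ 2 * |pair u (scale k) z (dd v (dd v K.η))| ≤
      C₂ * (1 + M) * scale k ^ 2 := by
    calc _ = scale k ^ 2 * ((scale k)⁻¹ ^ 2 * ((scale k)⁻¹ ^ 2 *
          |pair u (scale k) z (dd v (dd v K.η))|)) := by field_simp
      _ ≤ scale k ^ 2 * (C₂ * (1 + M)) := by gcongr
      _ = _ := by ring
  have : 0 ≤ C₂ * (1 + M) * scale k ^ 2 := by positivity
  linarith

end

section

/-! ### Nondegeneracy -/

namespace KernelPair

variable (K : KernelPair N)

lemma integral_inner_mul (d : 𝔼 N) : ∫ y, ⟪d, y⟫ * K.η y = 0 := by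
  have h := integral_neg_eq_self (fun y : 𝔼 N => ⟪d, y⟫ * K.η y) volume
  simp only [inner_neg_right, K.η_neg, neg_mul, integral_neg] at h
  linarith

lemma pair_le_of_paraboloid {f : (𝔼 N) → ℝ} {B a b t : ℝ} {x d : 𝔼 N} (hf : BddMeas B f)
    (ha : 0 ≤ a) (h : ∀ y, ‖y‖ ≤ 1 → f (x + t • y) ≤ b + ⟪d, y⟫ + a * ‖y‖ ^ 2) :
    pair f t x K.η ≤ b + a := by
  have hi : Integrable fun y => ⟪d, y⟫ * K.η y :=
    ((continuous_const.inner continuous_id).mul K.testη.continuous).integrable_of_hasCompactSupport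
      K.testη.hasCompactSupport.mul_left
  have hi' := K.testη.integrable.const_mul (b + a)
  calc pair f t x K.η ≤ ∫ y, ((b + a) * K.η y + ⟪d, y⟫ * K.η y) := by
        refine integral_mono (hf.integrable K.testη.integrable t x) (hi'.add hi) fun y => ?_
        dsimp only [Pi.add_apply]
        rw [← add_mul]
        rcases le_or_gt ‖y‖ 1 with hy | hy
        · refine mul_le_mul_of_nonneg_right ((h y hy).trans ?_) (K.η_nonneg y)
          have := mul_le_mul_of_nonneg_left (pow_le_one₀ (n := 2) (norm_nonneg y) hy) ha
          linarith
        · simp [K.testη.eq_zero hy]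
    _ = b + a := by
        rw [integral_add hi' hi, integral_const_mul, K.integralη, K.integral_inner_mul, mul_one,
          add_zero]

end KernelPair

namespace Sol

variable {M : ℝ} {z : 𝔼 N} {Ω : Set (𝔼 N)} {u : (𝔼 N) → ℝ} (K : KernelPair N)

lemma mul_integral_psi_le (S : Sol M z Ω u) {t : ℝ} (ht : 0 < t) {x : 𝔼 N}
    (hx : dist x z + t < 1) (hΩ : closedBall x t ⊆ Ω) :
    u x + t ^ 2 * (∫ y, K.ψ y) ≤ pair u t x K.η := by
  have hxb : x ∈ ball z 1 := by rw [mem_ball]; linarith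
  have hl := tendsto_pair S.bdd K.testη (S.diff x hxb).continuousAt t ht
  rw [K.integralη, mul_one] at hl
  have hstep : ∀ k : ℕ, pair u (t / 2 ^ k) x K.η - pair u (t / 2 ^ (k + 1)) x K.η =
      (t / 2 ^ k) ^ 2 * ∫ y, K.ψ y := fun k => by
    have htk : t / 2 ^ k ≤ t := div_le_self ht.le (one_le_pow₀ one_le_two)
    rw [pow_succ, ← div_div, S.two_scale (t := t / 2 ^ k) (x := x) K.testη K.testη K.testψ
      zero_le_one K.lap_eq (by positivity) (by linarith)]
    congr 1
    refine integral_congr_ae (ae_of_all _ fun y => ?_)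
    rcases le_or_gt ‖y‖ 1 with hy | hy
    · have hm : x + (t / 2 ^ k) • y ∈ Ω := hΩ <| by
        rw [mem_closedBall, dist_self_add_left, norm_smul, Real.norm_of_nonneg (by positivity)]
        nlinarith [norm_nonneg y]
      simp [chi, hm]
    · simp [K.testψ.eq_zero hy]
  have hI : 0 ≤ ∫ y, K.ψ y := integral_nonneg K.ψ_nonneg
  have hanti : Antitone fun k : ℕ => pair u (t / 2 ^ k) x K.η := antitone_nat_of_succ_le fun k => by
    have := mul_nonneg (sq_nonneg (t / 2 ^ k)) hI
    linarith [hstep k]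
  have h1 := hanti.le_of_tendsto hl 1
  have h0 := hstep 0
  rw [zero_add, pow_zero, div_one] at h0
  linarith

lemma le_bound (S : Sol M z Ω u) (hN : N ≠ 0) : (∫ y, K.ψ y) / 64 ≤ M := by
  have hI := K.integral_psi_pos hN
  set I := ∫ y, K.ψ y with hIdef
  by_contra! hM
  obtain ⟨y, hyΩ, hyz⟩ := Metric.mem_closure_iff.1 S.mem_closure (1 / 4) (by norm_num)
  rw [dist_comm] at hyz
  have hsub : ∀ x ∈ closedBall y (1 / 4), dist x z < 1 / 2 := fun x hx => by
    have := mem_closedBall.1 hx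
    linarith [dist_triangle x y z]
  set g : (𝔼 N) → ℝ := fun w => u w - I / 2 * ‖w - y‖ ^ 2 with hg
  obtain ⟨x, hxb, hmax⟩ := (isCompact_closedBall y (1 / 4)).exists_isMaxOn
    ⟨y, mem_closedBall_self (by norm_num)⟩ (f := g) fun w hw =>
      ((S.diff w (by rw [mem_ball]; linarith [hsub w hw])).continuousAt.sub
        (by fun_prop)).continuousWithinAt
  have hxz := hsub x hxb
  have hxb1 : x ∈ ball z 1 := by rw [mem_ball]; linarith
  have hxy : x ∈ ball y (1 / 4) := by
    refine lt_of_le_of_ne (mem_closedBall.1 hxb) fun heq => ?_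
    have h1 : g y ≤ g x := hmax (mem_closedBall_self (by norm_num))
    rw [dist_eq_norm] at heq
    simp only [hg, heq, sub_self, norm_zero] at h1
    have h2 := abs_le.1 (S.bdd.2 y)
    have h3 := abs_le.1 (S.bdd.2 x)
    norm_num at h1
    linarith
  by_cases hxΩ : x ∈ Ω
  · obtain ⟨ε, hε, hball⟩ := Metric.isOpen_iff.1 (S.isOpen.inter isOpen_ball) x ⟨hxΩ, hxy⟩
    set t := min (ε / 2) (1 / 4)
    have ht : 0 < t := by positivity
    have htε : t < ε := (min_le_left _ _).trans_lt (by linarith)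
    have hcb : closedBall x t ⊆ Ω ∩ ball y (1 / 4) := (closedBall_subset_ball htε).trans hball
    have h1 := S.mul_integral_psi_le K ht (x := x)
      (by linarith [min_le_right (ε / 2) (1 / 4 : ℝ)]) (hcb.trans inter_subset_left)
    have h2 := K.pair_le_of_paraboloid S.bdd (a := I / 2 * t ^ 2) (b := u x) (t := t) (x := x)
      (d := (I * t) • (x - y)) (by positivity) fun w hw => by
        have hm : x + t • w ∈ closedBall y (1 / 4) := ball_subset_closedBall (hcb (by
          rw [mem_closedBall, dist_self_add_left, norm_smul, Real.norm_of_nonneg ht.le]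
          nlinarith)).2
        have h3 : g (x + t • w) ≤ g x := hmax hm
        simp only [hg] at h3
        rw [add_sub_right_comm, norm_add_sq_real, norm_smul, Real.norm_of_nonneg ht.le,
          real_inner_smul_right] at h3
        rw [real_inner_smul_left]
        linarith
    have : 0 < t ^ 2 * I := by positivity
    linarith
  · have hd := (S.crit x hxb1 hxΩ).2
    have h1 : HasFDerivAt g (0 - (I / 2) • (2 • innerSL ℝ (x - y))) x := by
      have h2 := ((hasFDerivAt_id x).sub_const y).norm_sq.const_mul (I / 2)
      have h3 := (S.diff x hxb1).hasFDerivAt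
      rw [hd] at h3
      exact h3.sub h2
    have h4 := (hmax.isLocalMax (mem_of_superset (isOpen_ball.mem_nhds hxy)
      ball_subset_closedBall)).hasFDerivAt_eq_zero h1
    have h5 := congrArg (fun L : (𝔼 N) →L[ℝ] ℝ => L (x - y)) h4
    simp [hI.ne'] at h5
    rw [← inner_sub_left, inner_self_eq_zero, sub_eq_zero] at h5
    exact hxΩ (h5 ▸ hyΩ)

end Sol

end

end

/-- the doubling estimate `S_j ≤ C₀ M 2^{-2j}` on the set `𝕄(z,u)`. -/
theorem doubling_estimate (N : ℕ) (hN : 2 ≤ N) :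
    ∃ C₀ : ℝ, 0 < C₀ ∧
      ∀ (M : ℝ), 0 < M →
        ∀ (Ω : Set (EuclideanSpace ℝ (Fin N))) (z : EuclideanSpace ℝ (Fin N))
          (u : EuclideanSpace ℝ (Fin N) → ℝ),
          MemP N 1 z M Ω u →
            ∀ j : ℕ, 4 * Sj N z u (j + 1) ≥ Sj N z u j →
              Sj N z u j ≤ C₀ * M * (2 : ℝ) ^ (-(2 * (j : ℤ))) := by
  obtain ⟨K⟩ := exists_kernelPair (N := N) (by omega)
  obtain ⟨C, hC, hgrowth⟩ := K.exists_quadratic_growth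
  have hI := K.integral_psi_pos (by omega)
  set c := (∫ y, K.ψ y) / 64 with hc
  have hc0 : 0 < c := by positivity
  refine ⟨4 + C * (1 / c + 1), by positivity, fun M hM Ω z u hu j _ => ?_⟩
  have S := MemP.sol hM.le hu
  have hcM : 1 + M ≤ (1 / c + 1) * M := by
    have h1 : 1 ≤ M / c := (one_le_div hc0).2 (S.le_bound K (by omega))
    calc 1 + M ≤ M / c + M := by gcongr
      _ = _ := by ring
  have hpow : (2 : ℝ) ^ (-(2 * (j : ℤ))) = ((2 : ℝ) ^ (-(j : ℤ))) ^ 2 := by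
    rw [← zpow_natCast, ← zpow_mul]
    congr 1
    push_cast
    ring
  have hs0 : (0 : ℝ) < 2 ^ (-(j : ℤ)) := by positivity
  have hs1 : (2 : ℝ) ^ (-(j : ℤ)) ≤ 1 := zpow_le_one_of_nonpos₀ one_le_two (by simp)
  refine csSup_le ((nonempty_ball.2 hs0).image _) ?_
  rintro _ ⟨x, hx, rfl⟩
  have hx1 : x ∈ ball z 1 := ball_subset_ball hs1 hx
  have hCM : 0 ≤ C * (1 / c + 1) * M := by positivity
  rw [hpow]
  set s := (2 : ℝ) ^ (-(j : ℤ)) with hs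
  rcases lt_or_ge j 2 with hj | hj
  · have hs2 : 1 / 2 ≤ s := by
      interval_cases j <;> norm_num [hs]
    have hs4 : 1 / 4 ≤ s ^ 2 := by nlinarith
    have h1 := hu.2.2.2.2.1 x hx1
    calc |u x| ≤ 4 * M * (1 / 4) := by linarith
      _ ≤ (4 * M + C * (1 / c + 1) * M) * s ^ 2 := by gcongr; linarith
      _ = _ := by ring
  · obtain ⟨k, rfl⟩ := Nat.exists_eq_add_of_le' hj
    have hsk : s = scale k := by
      rw [hs, scale, zpow_neg, zpow_natCast, pow_add]
      field_simp
      norm_num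
    have h1 := hgrowth M z Ω _ S (x - z) k (by
      rw [← dist_eq_norm, ← hsk]
      exact (mem_ball.1 hx).le)
    rw [add_sub_cancel, indicator_of_mem hx1, ← hsk] at h1
    calc |u x| ≤ C * (1 + M) * s ^ 2 := h1
      _ ≤ C * ((1 / c + 1) * M) * s ^ 2 := by gcongr
      _ ≤ (4 * M + C * (1 / c + 1) * M) * s ^ 2 := by gcongr; linarith
      _ = _ := by ring
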